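/- Suppose (A1)-(A3) hold and let q ∈ S_+^d have all coordinates strictly positive. Then: (i) the function h_q(x) = exp(a(q)·x) − E_x(exp(a(q)·S(τ)); τ < ∞) is strictly positive and harmonic for the Markov chain (Z(t)); (ii) every sequence x_n ∈ ℤ_+^d with |x_n| → ∞ and x_n/|x_n| → q is fundamental for (Z(t)), and for every x ∈ ℤ_+^d, lim_n G(x,x_n)/G(x_0,x_n) = h_q(x)/h_q(x_0). -/

import Mathlib

open Filter Topology

attribute [local instance] Classical.propDecidable

noncomputable section

variable {V : Type*} [AddCommGroup V]

/-- `n`-step transition kernel of the random walk with step distribution `μ`,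
killed upon leaving the set `A` : `kern μ A n x y = P_x(S n = y, τ_A > n)`,
where `τ_A` is the first exit time from `A`. -/
def kern (μ : V → ℝ) (A : Set V) : ℕ → V → V → ℝ
  | 0 => fun x y => if x = y ∧ x ∈ A then 1 else 0
  | n + 1 => fun x y => ∑' z : V, (if x ∈ A then μ (z - x) else 0) * kern μ A n z y

/-- Green function of the walk killed outside `A`. -/
def green (μ : V → ℝ) (A : Set V) (x y : V) : ℝ :=
  ∑' n : ℕ, kern μ A n x y

/-- `E_x [ g(S τ) ; S τ ∈ B, τ < ∞ ]`, where `τ` is the first exit time from `A`. -/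
def exitExp (μ : V → ℝ) (A B : Set V) (g : V → ℝ) (x : V) : ℝ :=
  ∑' n : ℕ, ∑' z : V, kern μ A n x z *
    ∑' y : V, (if y ∉ A ∧ y ∈ B then μ (y - z) else 0) * g y

/-- `ℝ≥0∞`-valued version of `exitExp`. -/
def exitExpE (μ : V → ℝ) (A B : Set V) (g : V → ℝ) (x : V) : ENNReal :=
  ∑' n : ℕ, ∑' z : V, ENNReal.ofReal (kern μ A n x z) *
    ∑' y : V, ENNReal.ofReal ((if y ∉ A ∧ y ∈ B then μ (y - z) else 0) * g y)

/-- `P_x(S t = y for some t ≥ 0)` for the walk killed outside `A`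
(first passage decomposition). -/
def hitProb (μ : V → ℝ) (A : Set V) (x y : V) : ℝ :=
  (if x = y ∧ x ∈ A then 1 else 0) +
    ∑' n : ℕ, ∑' z : V, kern μ (A \ {y}) n x z * (if y ∈ A then μ (y - z) else 0)

/-- `h` is (strictly speaking, satisfies the mean value property of a) harmonic
function on `A` for the walk with step distribution `μ` killed outside `A`. -/
def HarmOn (μ : V → ℝ) (A : Set V) (h : V → ℝ) : Prop :=
  ∀ x ∈ A, h x = ∑' y : V, if y ∈ A then μ (y - x) * h y else 0

/-- Irreducibility of the walk killed outside `A`. -/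
def Irred (μ : V → ℝ) (A : Set V) : Prop :=
  ∀ x ∈ A, ∀ x' ∈ A, ∃ (k : ℕ) (c : ℕ → V), c 0 = x ∧ c k = x' ∧
    (∀ j ≤ k, c j ∈ A) ∧ ∀ j < k, 0 < μ (c (j + 1) - c j)

/-- A sequence `xs` is fundamental for the walk killed outside `A` :
the Martin kernels `G(x, xs n)/G(x₀, xs n)` converge for every `x ∈ A`. -/
def Fundamental (μ : V → ℝ) (A : Set V) (x₀ : V) (xs : ℕ → V) : Prop :=
  ∀ x ∈ A, ∃ L : ℝ,
    Tendsto (fun n => green μ A x (xs n) / green μ A x₀ (xs n)) atTop (𝓝 L)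

/-- ℓ¹-norm of an integer vector. -/
def znorm {ι : Type*} [Fintype ι] (x : ι → ℤ) : ℝ := ∑ i, |(x i : ℝ)|

/-- ℓ¹-norm of a real vector. -/
def rnorm {ι : Type*} [Fintype ι] (q : ι → ℝ) : ℝ := ∑ i, |q i|

variable {d : ℕ}

/-- `ℤ^{Λ,d}_+ = {x ∈ ℤ^d : xⁱ > 0 for all i ∈ Λ}`. -/
def posDom (Λ : Set (Fin d)) : Set (Fin d → ℤ) := {x | ∀ i ∈ Λ, 0 < x i}

/-- `ℤ^d_+ = {x ∈ ℤ^d : xⁱ > 0 for all i}`. -/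
def posAll : Set (Fin d → ℤ) := {x | ∀ i, 0 < x i}

/-- `a · z` for `a ∈ ℝ^d`, `z ∈ ℤ^d`. -/
def dotZ (a : Fin d → ℝ) (z : Fin d → ℤ) : ℝ := ∑ i, a i * (z i : ℝ)

/-- `a · q` for `a, q ∈ ℝ^d`. -/
def dotR (a q : Fin d → ℝ) : ℝ := ∑ i, a i * q i

/-- jump generating function `φ(a) = Σ_z μ(z) exp(a·z)` (valued in `ℝ≥0∞`). -/
def phiE (μ : (Fin d → ℤ) → ℝ) (a : Fin d → ℝ) : ENNReal :=
  ∑' z : Fin d → ℤ, ENNReal.ofReal (μ z * Real.exp (dotZ a z))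

/-- `D = {a ∈ ℝ^d : φ(a) ≤ 1}`. -/
def Dset (μ : (Fin d → ℤ) → ℝ) : Set (Fin d → ℝ) := {a | phiE μ a ≤ 1}

/-- mean vector `M = Σ_z μ(z) z`. -/
def Mvec (μ : (Fin d → ℤ) → ℝ) : Fin d → ℝ := fun i => ∑' z : Fin d → ℤ, μ z * (z i : ℝ)

/-- `Λ(M) = {i : Mⁱ = 0}`. -/
def LambdaM (μ : (Fin d → ℤ) → ℝ) : Set (Fin d) := {i | Mvec μ i = 0}

/-- Assumption (A1) : irreducibility on every `ℤ^{Λ,d}_+`. -/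
def A1 (μ : (Fin d → ℤ) → ℝ) : Prop := ∀ Λ : Set (Fin d), Irred μ (posDom Λ)

/-- Assumption (A2) : `φ` is finite on a neighborhood of the set `D`. -/
def A2 (μ : (Fin d → ℤ) → ℝ) : Prop :=
  ∃ U : Set (Fin d → ℝ), IsOpen U ∧ Dset μ ⊆ U ∧ ∀ a ∈ U, phiE μ a ≠ ⊤

/-- Assumption (A3) : `M ≠ 0`. -/
def A3 (μ : (Fin d → ℤ) → ℝ) : Prop := Mvec μ ≠ 0

/-- projection `x ↦ x^Λ`. -/
def projL (Λ : Set (Fin d)) (x : Fin d → ℤ) : ↥Λ → ℤ := fun i => x (i : Fin d)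

/-- jump distribution `μ_Λ(v) = Σ_{x : x^Λ = v} μ(x)` of the projected walk. -/
def muL (μ : (Fin d → ℤ) → ℝ) (Λ : Set (Fin d)) (v : ↥Λ → ℤ) : ℝ :=
  ∑' x : Fin d → ℤ, if projL Λ x = v then μ x else 0

/-- `ℤ^Λ_+`. -/
def posL (Λ : Set (Fin d)) : Set (↥Λ → ℤ) := {u | ∀ i, 0 < u i}

end

/-- `h_q(x) = exp(a(q)·x) − E_x(exp(a(q)·S(τ)); τ < ∞)`. -/
noncomputable def hq4 {d : ℕ} (μ : (Fin d → ℤ) → ℝ) (aq : Fin d → ℝ) (x : Fin d → ℤ) : ℝ :=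
  Real.exp (dotZ aq x) - exitExp μ posAll Set.univ (fun y => Real.exp (dotZ aq y)) x

section Convolution

open scoped ENNReal

variable {V : Type*} [AddCommGroup V]

/-- `convPow N n` is the `n`-fold convolution power of the weight `N`. -/
noncomputable def convPow (N : V → ℝ≥0∞) : ℕ → V → ℝ≥0∞
  | 0 => fun y => if y = 0 then 1 else 0
  | n + 1 => fun y => ∑' z, N z * convPow N n (y - z)

/-- Green function `∑ n, N^{*n}` of the unrestricted walk started at `0`. -/
noncomputable def convGreen (N : V → ℝ≥0∞) (y : V) : ℝ≥0∞ := ∑' n, convPow N n y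

/-- `ℝ≥0∞`-valued version of `kern`. -/
noncomputable def kernE (N : V → ℝ≥0∞) (A : Set V) : ℕ → V → V → ℝ≥0∞
  | 0 => fun x y => if x = y ∧ x ∈ A then 1 else 0
  | n + 1 => fun x y => ∑' z, (if x ∈ A then N (z - x) else 0) * kernE N A n z y

/-- `exitAt N A n x z` is the probability to leave `A` exactly at time `n + 1` and at `z`. -/
noncomputable def exitAt (N : V → ℝ≥0∞) (A : Set V) (n : ℕ) (x z : V) : ℝ≥0∞ :=
  ∑' w, kernE N A n x w * (if z ∉ A then N (z - w) else 0)

/-- Distribution of the exit position from `A`. -/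
noncomputable def exitDist (N : V → ℝ≥0∞) (A : Set V) (x z : V) : ℝ≥0∞ :=
  ∑' n, exitAt N A n x z

variable {N : V → ℝ≥0∞} {A : Set V}

lemma convPow_succ_sub (n : ℕ) (x y : V) :
    convPow N (n + 1) (y - x) = ∑' w, N (w - x) * convPow N n (y - w) := by
  rw [← (Equiv.addRight x).tsum_eq]
  simp [convPow, sub_add_eq_sub_sub_swap]

lemma convPow_add (j k : ℕ) (y : V) :
    convPow N (j + k) y = ∑' w, convPow N j w * convPow N k (y - w) := by
  induction j generalizing y with
  | zero =>
    rw [tsum_eq_single 0]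
    · simp [convPow]
    · intro b hb; simp [convPow, hb]
  | succ j ih =>
    rw [show j + 1 + k = (j + k) + 1 by ring]
    simp only [convPow, ih, ← ENNReal.tsum_mul_left, ← ENNReal.tsum_mul_right]
    rw [ENNReal.tsum_comm]
    conv_rhs => rw [ENNReal.tsum_comm]
    rw [ENNReal.tsum_comm]
    refine tsum_congr fun z => ?_
    rw [← (Equiv.subRight z).tsum_eq]
    refine tsum_congr fun w => ?_
    simp [mul_assoc]

lemma convPow_mul_le (j k : ℕ) (a b : V) :
    convPow N j a * convPow N k b ≤ convPow N (j + k) (a + b) := by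
  rw [convPow_add]
  refine le_trans ?_ (ENNReal.le_tsum a)
  simp

lemma convPow_one (z : V) : convPow N 1 z = N z := by
  simp only [convPow]
  rw [tsum_eq_single z]
  · simp
  · intro b hb
    simp [sub_eq_zero, Ne.symm hb]

lemma tsum_convPow_mul_le {w : V → ℝ≥0∞} (hw : ∀ a b, w (a + b) ≤ w a * w b) (n : ℕ) :
    ∑' y, convPow N n y * w y ≤ w 0 * (∑' z, N z * w z) ^ n := by
  induction n with
  | zero =>
    rw [tsum_eq_single 0]
    · simp [convPow]
    · intro b hb; simp [convPow, hb]
  | succ n ih =>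
    calc ∑' y, convPow N (n + 1) y * w y
        = ∑' z, ∑' y, N z * convPow N n (y - z) * w y := by
          simp only [convPow, ← ENNReal.tsum_mul_right]
          rw [ENNReal.tsum_comm]
      _ = ∑' z, ∑' y, N z * convPow N n y * w (y + z) := by
          refine tsum_congr fun z => ?_
          rw [← (Equiv.addRight z).tsum_eq]
          simp
      _ ≤ ∑' z, ∑' y, (N z * w z) * (convPow N n y * w y) := by
          refine ENNReal.tsum_le_tsum fun z => ENNReal.tsum_le_tsum fun y => ?_
          calc _ ≤ N z * convPow N n y * (w y * w z) := by gcongr; exact hw _ _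
            _ = _ := by ring
      _ = (∑' z, N z * w z) * ∑' y, convPow N n y * w y := by
          simp only [ENNReal.tsum_mul_left, ENNReal.tsum_mul_right]
      _ ≤ (∑' z, N z * w z) * (w 0 * (∑' z, N z * w z) ^ n) := by gcongr
      _ = _ := by ring

lemma convPow_mul_le_pow {w : V → ℝ≥0∞} (hw : ∀ a b, w (a + b) ≤ w a * w b) (n : ℕ) (y : V) :
    convPow N n y * w y ≤ w 0 * (∑' z, N z * w z) ^ n :=
  (ENNReal.le_tsum (f := fun y => convPow N n y * w y) y).trans (tsum_convPow_mul_le hw n)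

lemma tsum_convPow (hN : ∑' z, N z = 1) (n : ℕ) : ∑' y, convPow N n y = 1 := by
  induction n with
  | zero =>
    rw [tsum_eq_single 0]
    · simp [convPow]
    · intro b hb; simp [convPow, hb]
  | succ n ih =>
    simp only [convPow]
    rw [ENNReal.tsum_comm]
    simp only [ENNReal.tsum_mul_left]
    have : ∀ z, ∑' y, convPow N n (y - z) = 1 := fun z => by
      rw [← ih]; exact (Equiv.subRight z).tsum_eq (convPow N n)
    simp [this, hN]

lemma tsum_convPow_mul_convGreen_le (n : ℕ) (y : V) :
    ∑' w, convPow N n w * convGreen N (y - w) ≤ convGreen N y := by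
  simp only [convGreen, ← ENNReal.tsum_mul_left]
  rw [ENNReal.tsum_comm]
  simp only [← convPow_add]
  exact ENNReal.tsum_comp_le_tsum_of_injective (add_right_injective n) (fun k => convPow N k y)

lemma kernE_eq_zero {x : V} (hx : x ∉ A) (n : ℕ) (y : V) : kernE N A n x y = 0 := by
  cases n <;> simp [kernE, hx]

lemma exitAt_eq_zero {x : V} (hx : x ∉ A) (n : ℕ) (y : V) : exitAt N A n x y = 0 := by
  simp [exitAt, kernE_eq_zero hx]

lemma exitAt_zero {x : V} (hx : x ∈ A) (z : V) :
    exitAt N A 0 x z = if z ∉ A then N (z - x) else 0 := by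
  rw [exitAt, tsum_eq_single x]
  · simp [kernE, hx]
  · intro b hb
    simp [kernE, Ne.symm hb]

lemma exitAt_succ (n : ℕ) {x : V} (hx : x ∈ A) (z : V) :
    exitAt N A (n + 1) x z = ∑' w, N (w - x) * exitAt N A n w z := by
  simp only [exitAt, kernE, hx, if_true, ← ENNReal.tsum_mul_left, ← ENNReal.tsum_mul_right]
  rw [ENNReal.tsum_comm]
  simp only [mul_assoc]

lemma kernE_le_convPow (n : ℕ) (x y : V) : kernE N A n x y ≤ convPow N n (y - x) := by
  induction n generalizing x with
  | zero =>
    simp only [kernE, convPow, sub_eq_zero]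
    split_ifs with h1 h2 <;> simp_all
  | succ n ih =>
    rw [convPow_succ_sub]
    simp only [kernE]
    gcongr with z
    · split_ifs <;> simp
    · exact ih z

lemma exitAt_le_convPow (n : ℕ) (x z : V) : exitAt N A n x z ≤ convPow N (n + 1) (z - x) := by
  rw [convPow_add, exitAt, ← (Equiv.addRight x).tsum_eq]
  gcongr with w
  · simpa using kernE_le_convPow n x (w + x)
  · rw [convPow_one, show z - x - w = z - (w + x) by rw [sub_sub, add_comm]]
    split_ifs
    · simp
    · simp

lemma exitAt_of_mem (n : ℕ) (x : V) {z : V} (hz : z ∈ A) : exitAt N A n x z = 0 := by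
  simp [exitAt, hz]

/-- Decomposition of the walk at its exit from `A`. -/
lemma convPow_succ_eq (n : ℕ) {x : V} (hx : x ∈ A) (y : V) :
    convPow N (n + 1) (y - x) = kernE N A (n + 1) x y +
      ∑ p ∈ Finset.HasAntidiagonal.antidiagonal n, ∑' z, exitAt N A p.1 x z * convPow N p.2 (y - z) := by
  have key : ∀ (n : ℕ), (∀ w ∈ A, convPow N n (y - w) = kernE N A n w y +
      ∑ k ∈ Finset.range n, ∑' z, exitAt N A k w z * convPow N (n - 1 - k) (y - z)) := by
    intro n
    induction n with
    | zero =>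
      intro w hw
      simp [convPow, kernE, hw, sub_eq_zero, eq_comm]
    | succ n ih =>
      intro x hx
      rw [convPow_succ_sub, Finset.sum_range_succ']
      have h0 : ∀ w, N (w - x) * convPow N n (y - w) =
          (N (w - x) * kernE N A n w y + N (w - x) *
          ∑ k ∈ Finset.range n, ∑' z, exitAt N A k w z * convPow N (n - 1 - k) (y - z))
          + (if w ∉ A then N (w - x) else 0) * convPow N n (y - w) := by
        intro w
        by_cases hw : w ∈ A
        · rw [ih w hw]; simp [hw, mul_add]
        · simp [hw, kernE_eq_zero hw, exitAt_eq_zero hw]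
      simp only [h0, ENNReal.tsum_add, kernE, hx, if_true]
      rw [add_assoc]
      congr 1
      congr 1
      · simp only [Finset.mul_sum]
        rw [Summable.tsum_finsetSum (fun _ _ => ENNReal.summable)]
        refine Finset.sum_congr rfl fun k hk => ?_
        have : n + 1 - 1 - (k + 1) = n - 1 - k := by omega
        simp only [exitAt_succ k hx, ← ENNReal.tsum_mul_left, ← ENNReal.tsum_mul_right, this]
        rw [ENNReal.tsum_comm]
        simp only [mul_assoc]
      · simp [exitAt_zero hx]
  rw [key (n + 1) x hx, Finset.Nat.sum_antidiagonal_eq_sum_range_succ_mk]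
  simp

lemma convGreen_eq {x : V} (hx : x ∈ A) (y : V) :
    convGreen N (y - x) = (∑' n, kernE N A n x y) +
      ∑' z, exitDist N A x z * convGreen N (y - z) := by
  have h : ∑' z, exitDist N A x z * convGreen N (y - z) =
      ∑' n, ∑ p ∈ Finset.HasAntidiagonal.antidiagonal n, ∑' z, exitAt N A p.1 x z * convPow N p.2 (y - z) := by
    calc ∑' z, exitDist N A x z * convGreen N (y - z)
        = ∑' p : ℕ × ℕ, ∑' z, exitAt N A p.1 x z * convPow N p.2 (y - z) := by
          rw [ENNReal.tsum_comm]
          refine tsum_congr fun z => ?_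
          rw [ENNReal.tsum_prod (f := fun a b => exitAt N A a x z * convPow N b (y - z))]
          simp only [ENNReal.tsum_mul_left, ENNReal.tsum_mul_right, exitDist, convGreen]
      _ = _ := by
          rw [← (Finset.HasAntidiagonal.sigmaAntidiagonalEquivProd (A := ℕ)).tsum_eq, ENNReal.tsum_sigma']
          refine tsum_congr fun n => ?_
          rw [tsum_fintype, ← Finset.sum_coe_sort (Finset.HasAntidiagonal.antidiagonal n)]
          rfl
  rw [h, convGreen, tsum_eq_zero_add' ENNReal.summable,
    tsum_eq_zero_add' (f := fun n => kernE N A n x y) ENNReal.summable, add_assoc,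
    ← ENNReal.tsum_add]
  congr 1
  · simp [convPow, kernE, hx, sub_eq_zero, eq_comm]
  · exact tsum_congr fun n => convPow_succ_eq n hx y

lemma tsum_exitDist {x : V} (hx : x ∈ A) : ∑' z, exitDist N A x z =
    (∑' z, if z ∉ A then N (z - x) else 0) + ∑' w, N (w - x) * ∑' z, exitDist N A w z := by
  have h : ∀ z, exitDist N A x z =
      (if z ∉ A then N (z - x) else 0) + ∑' w, N (w - x) * exitDist N A w z := by
    intro z
    rw [exitDist, tsum_eq_zero_add' ENNReal.summable, exitAt_zero hx]
    simp only [exitAt_succ _ hx, exitDist, ← ENNReal.tsum_mul_left]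
    rw [ENNReal.tsum_comm]
  simp only [h, ENNReal.tsum_add, ← ENNReal.tsum_mul_left]
  rw [ENNReal.tsum_comm (f := fun a b => N (b - x) * exitDist N A b a)]

end Convolution

section StepCount

open scoped ENNReal

variable {V : Type*} [AddCommGroup V]

/-- `stepCount N u n k y` is the weight of the `n`-step paths from `0` to `y` that use the step `u`
exactly `k` times. -/
noncomputable def stepCount (N : V → ℝ≥0∞) (u : V) : ℕ → ℕ → V → ℝ≥0∞
  | 0, 0 => fun y => if y = 0 then 1 else 0
  | 0, _ + 1 => fun _ => 0
  | n + 1, 0 => fun y => ∑' z, (if z = u then 0 else N z) * stepCount N u n 0 (y - z)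
  | n + 1, k + 1 => fun y => N u * stepCount N u n k (y - u) +
      ∑' z, (if z = u then 0 else N z) * stepCount N u n (k + 1) (y - z)

variable {N : V → ℝ≥0∞} {u : V}

lemma stepCount_eq_zero {n k : ℕ} (h : n < k) (y : V) : stepCount N u n k y = 0 := by
  induction n generalizing k y with
  | zero => obtain ⟨k, rfl⟩ := Nat.exists_eq_succ_of_ne_zero h.ne'; simp [stepCount]
  | succ n ih =>
    obtain ⟨k, rfl⟩ := Nat.exists_eq_succ_of_ne_zero (by omega : k ≠ 0)
    simp [stepCount, ih (by omega : n < k), ih (by omega : n < k + 1)]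

lemma tsum_stepCount_mul_pow (s : ℝ≥0∞) (n : ℕ) (y : V) :
    ∑' k, stepCount N u n k y * s ^ k =
      convPow (fun z => N z * if z = u then s else 1) n y := by
  induction n generalizing y with
  | zero =>
    rw [tsum_eq_single 0]
    · simp [stepCount, convPow]
    · intro k hk
      simp [stepCount_eq_zero (Nat.pos_of_ne_zero hk)]
  | succ n ih =>
    have hκ : ∀ z, (N z * if z = u then s else 1) =
        (if z = u then N u * s else 0) + (if z = u then 0 else N z) := by
      intro z; by_cases h : z = u <;> simp [h]
    have h1 : ∑' z, (if z = u then N u * s else 0) *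
        convPow (fun z => N z * if z = u then s else 1) n (y - z) =
        N u * s * convPow (fun z => N z * if z = u then s else 1) n (y - u) := by
      rw [tsum_eq_single u]
      · simp
      · intro b hb; simp [hb]
    rw [tsum_eq_zero_add' ENNReal.summable]
    conv_rhs => simp only [convPow]
    conv_rhs => enter [1, z]; rw [hκ z, add_mul]
    rw [ENNReal.tsum_add, h1]
    simp only [← ih, stepCount, add_mul, ENNReal.tsum_add]
    conv_rhs => enter [2, 1, z]; rw [tsum_eq_zero_add' ENNReal.summable, mul_add]
    rw [ENNReal.tsum_add, ← add_assoc, add_left_comm, ← add_assoc]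
    simp only [← ENNReal.tsum_mul_left, ← ENNReal.tsum_mul_right]
    congr 1
    · congr 1 <;> exact tsum_congr fun k => by ring
    · rw [ENNReal.tsum_comm]
      simp only [mul_assoc]

lemma succ_mul_stepCount_succ (n k : ℕ) (y : V) :
    ((k + 1 : ℕ) : ℝ≥0∞) * stepCount N u (n + 1) (k + 1) y =
      ((n + 1 : ℕ) : ℝ≥0∞) * (N u * stepCount N u n k (y - u)) := by
  induction n generalizing k y with
  | zero => cases k <;> simp [stepCount]
  | succ n ih =>
    have h1 : ((k + 1 : ℕ) : ℝ≥0∞) * ∑' z, (if z = u then 0 else N z) *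
        stepCount N u (n + 1) (k + 1) (y - z) =
        ((n + 1 : ℕ) : ℝ≥0∞) * (N u * ∑' z, (if z = u then 0 else N z) *
          stepCount N u n k (y - u - z)) := by
      simp only [← ENNReal.tsum_mul_left]
      refine tsum_congr fun z => ?_
      rw [mul_left_comm, ih, sub_right_comm y z u]
      ring
    rw [stepCount, mul_add, h1]
    cases k with
    | zero =>
      rw [stepCount]
      push_cast
      ring
    | succ k =>
      have h2 : ((k + 1 : ℕ) : ℝ≥0∞) * (N u * stepCount N u (n + 1) (k + 1) (y - u)) =
          N u * (((n + 1 : ℕ) : ℝ≥0∞) * (N u * stepCount N u n k (y - u - u))) := by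
        rw [← ih]; ring
      rw [Nat.cast_add, Nat.cast_one, add_mul, h2]
      conv_rhs => rw [Nat.cast_add, Nat.cast_one, add_mul, stepCount]
      rw [stepCount]
      ring

lemma stepCount_sub_le {a s c : ℝ≥0∞} (hu : N u ≠ 0) (hu' : N u ≠ ∞)
    (h : ∀ n k : ℕ, c * (n * N u) < k → 1 ≤ a ^ n * s ^ k) (n k : ℕ) (y : V) :
    stepCount N u n k (y - u) ≤ c * stepCount N u (n + 1) (k + 1) y +
      (N u)⁻¹ * (a ^ (n + 1) * (stepCount N u (n + 1) (k + 1) y * s ^ (k + 1))) := by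
  have hn : ((n + 1 : ℕ) : ℝ≥0∞) ≠ 0 := by positivity
  have hn' : ((n + 1 : ℕ) : ℝ≥0∞) ≠ ∞ := ENNReal.natCast_ne_top _
  have h0 : ((n + 1 : ℕ) : ℝ≥0∞) * N u ≠ 0 := mul_ne_zero hn hu
  have h0' : ((n + 1 : ℕ) : ℝ≥0∞) * N u ≠ ∞ := ENNReal.mul_ne_top hn' hu'
  have key := succ_mul_stepCount_succ (N := N) (u := u) n k y
  rw [← mul_assoc] at key
  by_cases hk : c * ((n + 1 : ℕ) * N u) < (k + 1 : ℕ)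
  · refine le_trans ?_ le_add_self
    rcases lt_or_ge n k with hnk | hnk
    · simp [stepCount_eq_zero hnk]
    have h1 := h _ _ hk
    calc stepCount N u n k (y - u) ≤ (N u)⁻¹ * stepCount N u (n + 1) (k + 1) y := by
          rw [← ENNReal.mul_le_mul_iff_right h0 h0', ← key, mul_assoc, ← mul_assoc (N u),
            ENNReal.mul_inv_cancel hu hu', one_mul]
          gcongr
      _ = (N u)⁻¹ * (1 * stepCount N u (n + 1) (k + 1) y) := by rw [one_mul]
      _ ≤ (N u)⁻¹ * ((a ^ (n + 1) * s ^ (k + 1)) * stepCount N u (n + 1) (k + 1) y) := by gcongr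
      _ = _ := by ring
  · push Not at hk
    refine le_trans ?_ le_self_add
    rw [← ENNReal.mul_le_mul_iff_right h0 h0', ← key]
    calc _ ≤ c * ((n + 1 : ℕ) * N u) * stepCount N u (n + 1) (k + 1) y := by gcongr
      _ = _ := by ring

lemma convGreen_sub_le {a s c : ℝ≥0∞} (hu : N u ≠ 0) (hu' : N u ≠ ∞)
    (h : ∀ n k : ℕ, c * (n * N u) < k → 1 ≤ a ^ n * s ^ k) (y : V) :
    convGreen N (y - u) ≤ c * convGreen N y +
      (N u)⁻¹ * ∑' n, a ^ n * convPow (fun z => N z * if z = u then s else 1) n y := by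
  have hone : ∀ n y, convPow N n y = ∑' k, stepCount N u n k y := by
    intro n y
    have := tsum_stepCount_mul_pow (N := N) (u := u) 1 n y
    simpa using this.symm
  calc convGreen N (y - u) = ∑' n, ∑' k, stepCount N u n k (y - u) := by
        simp only [convGreen, hone]
    _ ≤ ∑' n, ∑' k, (c * stepCount N u (n + 1) (k + 1) y +
      (N u)⁻¹ * (a ^ (n + 1) * (stepCount N u (n + 1) (k + 1) y * s ^ (k + 1)))) :=
        ENNReal.tsum_le_tsum fun n => ENNReal.tsum_le_tsum fun k => stepCount_sub_le hu hu' h n k y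
    _ = c * ∑' n, ∑' k, stepCount N u (n + 1) (k + 1) y + (N u)⁻¹ *
        ∑' n, a ^ (n + 1) * ∑' k, stepCount N u (n + 1) (k + 1) y * s ^ (k + 1) := by
        simp only [ENNReal.tsum_add, ENNReal.tsum_mul_left]
    _ ≤ _ := by
        have hsucc : Function.Injective (fun n : ℕ => n + 1) := add_left_injective 1
        simp only [← tsum_stepCount_mul_pow (N := N) (u := u) s]
        refine add_le_add (mul_le_mul_right ?_ _) (mul_le_mul_right ?_ _)
        · refine le_trans ?_ (ENNReal.tsum_comp_le_tsum_of_injective hsucc _)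
          refine ENNReal.tsum_le_tsum fun n => ?_
          rw [hone]
          exact ENNReal.tsum_comp_le_tsum_of_injective hsucc (fun k => stepCount N u (n + 1) k y)
        · refine le_trans ?_ (ENNReal.tsum_comp_le_tsum_of_injective hsucc _)
          refine ENNReal.tsum_le_tsum fun n => mul_le_mul_right ?_ _
          exact ENNReal.tsum_comp_le_tsum_of_injective hsucc
            (fun k => stepCount N u (n + 1) k y * s ^ k)

end StepCount

section LatticeNorm

variable {d : ℕ}

lemma znorm_nonneg (x : Fin d → ℤ) : 0 ≤ znorm x := Finset.sum_nonneg fun _ _ => abs_nonneg _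

lemma znorm_zero : znorm (0 : Fin d → ℤ) = 0 := by simp [znorm]

lemma znorm_add_le (x y : Fin d → ℤ) : znorm (x + y) ≤ znorm x + znorm y := by
  rw [znorm, znorm, znorm, ← Finset.sum_add_distrib]
  refine Finset.sum_le_sum fun i _ => ?_
  push_cast [Pi.add_apply]
  exact abs_add_le _ _

lemma znorm_sub_le (x y : Fin d → ℤ) : znorm (x - y) ≤ znorm x + znorm y := by
  rw [znorm, znorm, znorm, ← Finset.sum_add_distrib]
  refine Finset.sum_le_sum fun i _ => ?_
  push_cast [Pi.sub_apply]
  exact abs_sub _ _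

lemma abs_apply_le_znorm (x : Fin d → ℤ) (i : Fin d) : |(x i : ℝ)| ≤ znorm x :=
  Finset.single_le_sum (f := fun i => |(x i : ℝ)|) (fun _ _ => abs_nonneg _) (Finset.mem_univ i)

lemma abs_dotZ_le {a : Fin d → ℝ} {K : ℝ} (ha : ∀ i, |a i| ≤ K) (x : Fin d → ℤ) :
    |dotZ a x| ≤ K * znorm x := by
  rw [znorm, Finset.mul_sum]
  refine (Finset.abs_sum_le_sum_abs _ _).trans (Finset.sum_le_sum fun i _ => ?_)
  rw [abs_mul]
  exact mul_le_mul_of_nonneg_right (ha i) (abs_nonneg _)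

lemma dotZ_add (a : Fin d → ℝ) (x y : Fin d → ℤ) : dotZ a (x + y) = dotZ a x + dotZ a y := by
  simp [dotZ, mul_add, Finset.sum_add_distrib]

lemma dotZ_zero (a : Fin d → ℝ) : dotZ a 0 = 0 := by simp [dotZ]

lemma dotZ_add_left (a b : Fin d → ℝ) (x : Fin d → ℤ) : dotZ (a + b) x = dotZ a x + dotZ b x := by
  simp [dotZ, add_mul, Finset.sum_add_distrib]

/-- `e` is plus or minus a vector of the standard basis. -/
def IsUnitStep (e : Fin d → ℤ) : Prop := ∃ i, e = Pi.single i 1 ∨ e = Pi.single i (-1)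

lemma finite_isUnitStep : {e : Fin d → ℤ | IsUnitStep e}.Finite := by
  refine ((Set.finite_range fun i : Fin d => (Pi.single i 1 : Fin d → ℤ)).union
    (Set.finite_range fun i : Fin d => (Pi.single i (-1) : Fin d → ℤ))).subset ?_
  rintro e ⟨i, rfl | rfl⟩
  · exact Or.inl ⟨i, rfl⟩
  · exact Or.inr ⟨i, rfl⟩

lemma exists_isUnitStep {z : Fin d → ℤ} (hz : z ≠ 0) :
    ∃ z' e, IsUnitStep e ∧ z = z' + e ∧ znorm z = znorm z' + 1 := by
  obtain ⟨i, hi⟩ := Function.ne_iff.1 hz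
  have key : ∀ s : ℤ, |(z i : ℝ)| = |((z i - s : ℤ) : ℝ)| + 1 →
      znorm z = znorm (z - Pi.single i s) + 1 := by
    intro s hs
    have h1 : ∀ j, |(z j : ℝ)| = |((z - Pi.single i s : Fin d → ℤ) j : ℝ)| + if j = i then 1 else 0 := by
      intro j
      rcases eq_or_ne j i with rfl | hj
      · simpa using hs
      · simp [hj]
    rw [znorm, Finset.sum_congr rfl fun j _ => h1 j, Finset.sum_add_distrib]
    simp [znorm]
  rcases lt_or_gt_of_ne hi with h | h
  · refine ⟨z - Pi.single i (-1), Pi.single i (-1), ⟨i, Or.inr rfl⟩, by simp, key _ ?_⟩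
    have h' : (z i : ℝ) ≤ -1 := by exact_mod_cast Int.le_sub_one_of_lt h
    push_cast
    rw [abs_of_nonpos (by linarith), abs_of_nonpos (by linarith)]
    ring
  · refine ⟨z - Pi.single i 1, Pi.single i 1, ⟨i, Or.inl rfl⟩, by simp, key _ ?_⟩
    have h' : (1 : ℝ) ≤ z i := by exact_mod_cast Int.add_one_le_of_lt h
    push_cast
    rw [abs_of_nonneg (by linarith), abs_of_nonneg (by linarith)]
    ring

lemma unitStep_induction {P : (Fin d → ℤ) → Prop} (h0 : P 0)
    (hs : ∀ z e, IsUnitStep e → znorm (z + e) = znorm z + 1 → P z → P (z + e)) (z : Fin d → ℤ) :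
    P z := by
  have : ∀ (k : ℕ) (z : Fin d → ℤ), znorm z < k → P z := by
    intro k
    induction k with
    | zero => intro z hz; exact absurd hz (by simpa using znorm_nonneg z)
    | succ k ih =>
      intro z hz
      by_cases h : z = 0
      · rwa [h]
      obtain ⟨z', e, he, rfl, hn⟩ := exists_isUnitStep h
      refine hs _ _ he hn (ih _ ?_)
      push_cast at hz
      linarith
  obtain ⟨k, hk⟩ := exists_nat_gt (znorm z)
  exact this k z hk

end LatticeNorm

section ExpMoment

variable {d : ℕ} {ν : (Fin d → ℤ) → ℝ}

lemma exp_le_one_add_add (x : ℝ) : Real.exp x ≤ 1 + x + x ^ 2 * Real.exp |x| := by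
  have h := Complex.norm_exp_sub_sum_le_norm_mul_exp (x : ℂ) 2
  have h1 : Complex.exp x - ∑ m ∈ Finset.range 2, (x : ℂ) ^ m / m.factorial =
      ((Real.exp x - (1 + x) : ℝ) : ℂ) := by
    simp [Finset.sum_range_succ]
  rw [h1, Complex.norm_real, Complex.norm_real, Real.norm_eq_abs, Real.norm_eq_abs, sq_abs] at h
  linarith [(abs_le.1 h).2]

/-- Second order Taylor bound for the Laplace transform of a law with exponential moments. -/
lemma exists_laplace_bound (hν : ∀ z, 0 ≤ ν z) {r : ℝ} (hr : 0 < r)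
    (hs : Summable fun z => ν z * Real.exp (r * znorm z)) :
    ∃ s₀ > 0, ∃ C ≥ 0, ∀ (g : (Fin d → ℤ) → ℝ) (s : ℝ), s ≤ s₀ →
      (∀ z, |g z| ≤ s * (1 + znorm z)) →
      Summable (fun z => ν z * g z) ∧ Summable (fun z => ν z * Real.exp (g z)) ∧
      ∑' z, ν z * Real.exp (g z) ≤ ∑' z, ν z + ∑' z, ν z * g z + C * s ^ 2 := by
  set s₀ : ℝ := r / 2 with hs₀
  have hs₀p : 0 < s₀ := by positivity
  set B : ℝ := 2 / s₀ ^ 2 * Real.exp r with hB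
  have hB0 : 0 ≤ B := by positivity
  have hν1 : Summable ν := by
    refine hs.of_nonneg_of_le hν fun z => le_mul_of_one_le_right (hν z) ?_
    exact Real.one_le_exp (mul_nonneg hr.le (znorm_nonneg z))
  have hpoly : ∀ z : Fin d → ℤ, (1 + znorm z) ^ 2 * Real.exp (s₀ * (1 + znorm z)) ≤
      B * Real.exp (r * znorm z) := by
    intro z
    set t := 1 + znorm z
    have ht : 0 ≤ t := by have := znorm_nonneg z; positivity
    have h1 := Real.pow_div_factorial_le_exp (s₀ * t) (by positivity) 2
    have h2 : t ^ 2 ≤ 2 / s₀ ^ 2 * Real.exp (s₀ * t) := by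
      rw [div_mul_eq_mul_div, le_div_iff₀ (by positivity)]
      norm_num [Nat.factorial] at h1
      nlinarith
    calc t ^ 2 * Real.exp (s₀ * t)
        ≤ 2 / s₀ ^ 2 * Real.exp (s₀ * t) * Real.exp (s₀ * t) := by gcongr
      _ = 2 / s₀ ^ 2 * (Real.exp (s₀ * t) * Real.exp (s₀ * t)) := by ring
      _ = 2 / s₀ ^ 2 * (Real.exp r * Real.exp (r * znorm z)) := by
          rw [← Real.exp_add, ← Real.exp_add]; congr 2; simp only [hs₀, t]; ring
      _ = _ := by rw [hB]; ring
  refine ⟨s₀, hs₀p, B * ∑' z, ν z * Real.exp (r * znorm z),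
    mul_nonneg hB0 (tsum_nonneg fun z => mul_nonneg (hν z) (Real.exp_pos _).le), ?_⟩
  intro g s hss hg
  have hone : ∀ z : Fin d → ℤ, 1 ≤ 1 + znorm z := fun z => by linarith [znorm_nonneg z]
  have hs0 : 0 ≤ s := by
    by_contra hneg
    push Not at hneg
    have h1 := (abs_nonneg _).trans (hg 0)
    have h2 := hone 0
    nlinarith
  have hlin : ∀ z : Fin d → ℤ, 1 + znorm z ≤ B * Real.exp (r * znorm z) := by
    intro z
    refine le_trans ?_ (hpoly z)
    have h1 : 1 ≤ Real.exp (s₀ * (1 + znorm z)) :=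
      Real.one_le_exp (mul_nonneg hs₀p.le (by linarith [hone z]))
    nlinarith [hone z, sq_nonneg (1 + znorm z)]
  have hquad : ∀ z, g z ^ 2 * Real.exp |g z| ≤ s ^ 2 * (B * Real.exp (r * znorm z)) := by
    intro z
    have h1 : g z ^ 2 ≤ s ^ 2 * (1 + znorm z) ^ 2 := by
      rw [← sq_abs, ← mul_pow]
      exact pow_le_pow_left₀ (abs_nonneg _) (hg z) 2
    have h2 : |g z| ≤ s₀ * (1 + znorm z) :=
      (hg z).trans (mul_le_mul_of_nonneg_right hss (by linarith [hone z]))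
    calc g z ^ 2 * Real.exp |g z| ≤ (s ^ 2 * (1 + znorm z) ^ 2) * Real.exp (s₀ * (1 + znorm z)) := by
          gcongr
      _ = s ^ 2 * ((1 + znorm z) ^ 2 * Real.exp (s₀ * (1 + znorm z))) := by ring
      _ ≤ _ := mul_le_mul_of_nonneg_left (hpoly z) (sq_nonneg s)
  have hsum1 : Summable (fun z => ν z * g z) := by
    refine Summable.of_norm_bounded (hs.mul_left (s * B)) fun z => ?_
    rw [norm_mul, Real.norm_of_nonneg (hν z), Real.norm_eq_abs]
    calc ν z * |g z| ≤ ν z * (s * (B * Real.exp (r * znorm z))) := by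
          have := hν z
          gcongr
          exact (hg z).trans (by gcongr; exact hlin z)
      _ = _ := by ring
  have hle : ∀ z, ν z * Real.exp (g z) ≤ ν z + ν z * g z +
      s ^ 2 * B * (ν z * Real.exp (r * znorm z)) := by
    intro z
    calc ν z * Real.exp (g z) ≤ ν z * (1 + g z + s ^ 2 * (B * Real.exp (r * znorm z))) :=
          mul_le_mul_of_nonneg_left
            (by linarith [exp_le_one_add_add (g z), hquad z]) (hν z)
      _ = _ := by ring
  have hsumR := (hν1.add hsum1).add (hs.mul_left (s ^ 2 * B))
  have hsum2 : Summable (fun z => ν z * Real.exp (g z)) :=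
    hsumR.of_nonneg_of_le (fun z => mul_nonneg (hν z) (Real.exp_pos _).le) hle
  refine ⟨hsum1, hsum2, (hsum2.tsum_le_tsum hle hsumR).trans (le_of_eq ?_)⟩
  rw [(hν1.add hsum1).tsum_add (hs.mul_left _), hν1.tsum_add hsum1, tsum_mul_left]
  ring

end ExpMoment

section DriftLaw

open scoped ENNReal

variable {d : ℕ} {ν : (Fin d → ℤ) → ℝ} {m : Fin d → ℝ}

/-- A probability law on `ℤ^d` with exponential moments, generating `ℤ^d` as a semigroup, and with
mean vector `m` all of whose coordinates are positive. -/
structure DriftLaw (ν : (Fin d → ℤ) → ℝ) (m : Fin d → ℝ) : Prop where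
  nonneg : ∀ z, 0 ≤ ν z
  hasSum : HasSum ν 1
  expMoment : ∃ r > 0, Summable fun z => ν z * Real.exp (r * znorm z)
  mean : ∀ i, HasSum (fun z => ν z * (z i : ℝ)) (m i)
  mean_pos : ∀ i, 0 < m i
  dim_pos : 0 < d
  irred : Irred ν Set.univ

/-- `ℝ≥0∞`-valued version of the weight `ν`. -/
noncomputable def toWeight (ν : (Fin d → ℤ) → ℝ) (z : Fin d → ℤ) : ℝ≥0∞ := ENNReal.ofReal (ν z)

lemma hasSum_mul_dotZ (hm : ∀ i, HasSum (fun z => ν z * (z i : ℝ)) (m i)) (a : Fin d → ℝ) :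
    HasSum (fun z => ν z * dotZ a z) (dotR a m) := by
  have h := hasSum_sum (s := Finset.univ) fun i _ => (hm i).mul_left (a i)
  have heq : (fun z => ν z * dotZ a z) = fun z => ∑ i, a i * (ν z * (z i : ℝ)) := by
    funext z
    rw [dotZ, Finset.mul_sum]
    exact Finset.sum_congr rfl fun i _ => by ring
  rw [heq]
  exact h

namespace DriftLaw

lemma tsum_weight (h : DriftLaw ν m) : ∑' z, toWeight ν z = 1 := by
  simp only [toWeight]
  rw [← ENNReal.ofReal_tsum_of_nonneg h.nonneg h.hasSum.summable, h.hasSum.tsum_eq,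
    ENNReal.ofReal_one]

lemma exists_laplace (h : DriftLaw ν m) :
    ∃ s₀ > 0, ∃ C > 0, ∀ (g : (Fin d → ℤ) → ℝ) (s : ℝ), s ≤ s₀ →
      (∀ z, |g z| ≤ s * (1 + znorm z)) →
      Summable (fun z => ν z * g z) ∧
      ∑' z, toWeight ν z * ENNReal.ofReal (Real.exp (g z)) ≤
        ENNReal.ofReal (Real.exp (∑' z, ν z * g z + C * s ^ 2)) := by
  obtain ⟨r, hr, hs⟩ := h.expMoment
  obtain ⟨s₀, hs₀, C, hC, hb⟩ := exists_laplace_bound h.nonneg hr hs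
  refine ⟨s₀, hs₀, C + 1, by positivity, fun g s hss hg => ?_⟩
  obtain ⟨h1, h2, h3⟩ := hb g s hss hg
  refine ⟨h1, ?_⟩
  simp only [toWeight, ← ENNReal.ofReal_mul (h.nonneg _)]
  rw [← ENNReal.ofReal_tsum_of_nonneg (fun z => mul_nonneg (h.nonneg z) (Real.exp_pos _).le) h2]
  refine ENNReal.ofReal_le_ofReal (h3.trans ?_)
  rw [h.hasSum.tsum_eq]
  have := Real.add_one_le_exp (∑' z, ν z * g z + (C + 1) * s ^ 2)
  nlinarith [sq_nonneg s]

lemma sum_mean_pos (h : DriftLaw ν m) : 0 < ∑ i, m i := by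
  have : Nonempty (Fin d) := ⟨⟨0, h.dim_pos⟩⟩
  exact Finset.sum_pos (fun i _ => h.mean_pos i) Finset.univ_nonempty

lemma dotR_const (m : Fin d → ℝ) (t : ℝ) : dotR (fun _ => t) m = t * ∑ i, m i := by
  simp [dotR, Finset.mul_sum]

lemma dotZ_const_le {t : ℝ} (ht : 0 ≤ t) (z : Fin d → ℤ) :
    |dotZ (fun _ => t) z| ≤ t * znorm z := abs_dotZ_le (fun _ => (abs_of_nonneg ht).le) z

lemma geometric_ofReal_exp {x : ℝ} (hx : x < 0) :
    ∑' n : ℕ, ENNReal.ofReal (Real.exp x) ^ n = ENNReal.ofReal ((1 - Real.exp x)⁻¹) := by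
  have h1 : Real.exp x < 1 := Real.exp_lt_one_iff.2 hx
  rw [ENNReal.tsum_geometric, ENNReal.ofReal_inv_of_pos (by linarith),
    ENNReal.ofReal_sub _ (Real.exp_pos x).le, ENNReal.ofReal_one]

/-- The Green function grows at most at a small exponential rate. -/
lemma exists_convGreen_le (h : DriftLaw ν m) {θ₀ : ℝ} (hθ₀ : 0 < θ₀) :
    ∃ K > 0, ∀ y, convGreen (toWeight ν) y ≤ ENNReal.ofReal (K * Real.exp (θ₀ * znorm y)) := by
  obtain ⟨s₀, hs₀, C, hC, hb⟩ := h.exists_laplace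
  have hM := h.sum_mean_pos
  set M := ∑ i, m i
  obtain ⟨θ, hθ, hθ1, hθ2, hθ3⟩ : ∃ θ > 0, θ ≤ s₀ ∧ θ ≤ θ₀ ∧ C * θ ≤ M / 2 := by
    refine ⟨min s₀ (min θ₀ (M / (2 * C))), by positivity, min_le_left _ _,
      (min_le_right _ _).trans (min_le_left _ _), ?_⟩
    calc C * min s₀ (min θ₀ (M / (2 * C))) ≤ C * (M / (2 * C)) := by
          gcongr; exact (min_le_right _ _).trans (min_le_right _ _)
      _ = M / 2 := by field_simp
  set a : Fin d → ℝ := fun _ => -θ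
  have habs : ∀ z, |dotZ a z| ≤ θ * znorm z := fun z =>
    abs_dotZ_le (fun _ => by simp [a, abs_of_pos hθ]) z
  obtain ⟨-, h2⟩ := hb (dotZ a) θ hθ1 fun z => (habs z).trans (by gcongr; linarith)
  rw [(hasSum_mul_dotZ h.mean a).tsum_eq, dotR_const] at h2
  set x := -θ * M + C * θ ^ 2
  have hx : x < 0 := by
    have : C * θ ^ 2 ≤ θ * (M / 2) := by nlinarith
    have : 0 < θ * M := by positivity
    simp only [x]; linarith
  refine ⟨(1 - Real.exp x)⁻¹, by have := Real.exp_lt_one_iff.2 hx; exact inv_pos.2 (by linarith), ?_⟩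
  intro y
  have hw : ∀ z w, ENNReal.ofReal (Real.exp (dotZ a (z + w))) ≤
      ENNReal.ofReal (Real.exp (dotZ a z)) * ENNReal.ofReal (Real.exp (dotZ a w)) := by
    intro z w
    rw [← ENNReal.ofReal_mul (Real.exp_pos _).le, ← Real.exp_add, dotZ_add]
  have hn : ∀ n, convPow (toWeight ν) n y * ENNReal.ofReal (Real.exp (dotZ a y)) ≤
      ENNReal.ofReal (Real.exp x) ^ n := by
    intro n
    refine (convPow_mul_le_pow hw n y).trans ?_
    simp only [dotZ_zero, Real.exp_zero, ENNReal.ofReal_one, one_mul]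
    gcongr
  have hsum : convGreen (toWeight ν) y * ENNReal.ofReal (Real.exp (dotZ a y)) ≤
      ENNReal.ofReal ((1 - Real.exp x)⁻¹) := by
    rw [← geometric_ofReal_exp hx, convGreen, ← ENNReal.tsum_mul_right]
    exact ENNReal.tsum_le_tsum hn
  have hcancel : ENNReal.ofReal (Real.exp (dotZ a y)) * ENNReal.ofReal (Real.exp (-dotZ a y)) = 1 := by
    rw [← ENNReal.ofReal_mul (Real.exp_pos _).le, ← Real.exp_add]; simp
  calc convGreen (toWeight ν) y = convGreen (toWeight ν) y * ENNReal.ofReal (Real.exp (dotZ a y)) *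
        ENNReal.ofReal (Real.exp (-dotZ a y)) := by rw [mul_assoc, hcancel, mul_one]
    _ ≤ ENNReal.ofReal ((1 - Real.exp x)⁻¹) * ENNReal.ofReal (Real.exp (θ₀ * znorm y)) := by
        gcongr
        calc -dotZ a y ≤ θ * znorm y := (neg_le_abs _).trans (habs y)
          _ ≤ _ := by gcongr; exact znorm_nonneg y
    _ = _ := by
        rw [ENNReal.ofReal_mul]
        have := Real.exp_lt_one_iff.2 hx
        exact inv_nonneg.2 (by linarith)

lemma convGreen_ne_top (h : DriftLaw ν m) (y : Fin d → ℤ) : convGreen (toWeight ν) y ≠ ∞ := by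
  obtain ⟨K, -, hK⟩ := h.exists_convGreen_le one_pos
  exact ne_top_of_le_ne_top ENNReal.ofReal_ne_top (hK y)

/-- Moving the target of the Green function by one step of the walk changes it at most by a factor
close to one, up to an exponentially small error. -/
lemma exists_convGreen_sub_step_le (h : DriftLaw ν m) {u : Fin d → ℤ} (hu : 0 < ν u) {ε : ℝ}
    (hε : 0 < ε) : ∃ c > 0, ∃ K > 0, ∀ y, convGreen (toWeight ν) (y - u) ≤
      ENNReal.ofReal (1 + ε) * convGreen (toWeight ν) y +
        ENNReal.ofReal (K * Real.exp (-dotZ (fun _ => c) y)) := by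
  obtain ⟨s₀, hs₀, C, hC, hb⟩ := h.exists_laplace
  have hM := h.sum_mean_pos
  set M := ∑ i, m i
  set p := ν u
  obtain ⟨κ, hκ, hκ1, hκ2⟩ : ∃ κ > 0, κ ≤ 1 ∧ κ * M ≤ ε * p / 4 := by
    refine ⟨min 1 (ε * p / (4 * M)), by positivity, min_le_left _ _, ?_⟩
    calc min 1 (ε * p / (4 * M)) * M ≤ (ε * p / (4 * M)) * M := by gcongr; exact min_le_right _ _
      _ = _ := by field_simp
  obtain ⟨θ, hθ, hθ1, hθ2⟩ : ∃ θ > 0, 2 * θ ≤ s₀ ∧ 4 * C * θ ≤ ε * p / 4 := by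
    refine ⟨min (s₀ / 2) (ε * p / (16 * C)), by positivity, ?_, ?_⟩
    · linarith [min_le_left (s₀ / 2) (ε * p / (16 * C))]
    · calc 4 * C * min (s₀ / 2) (ε * p / (16 * C)) ≤ 4 * C * (ε * p / (16 * C)) := by
            gcongr; exact min_le_right _ _
        _ = _ := by field_simp; ring
  set b : Fin d → ℝ := fun _ => κ * θ
  set g : (Fin d → ℤ) → ℝ := fun z => (if z = u then θ else 0) + dotZ b z with hg
  have habs : ∀ z, |g z| ≤ (2 * θ) * (1 + znorm z) := by
    intro z
    have h1 : |dotZ b z| ≤ κ * θ * znorm z := dotZ_const_le (by positivity) z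
    have h2 : |if z = u then θ else 0| ≤ θ := by split_ifs <;> simp [abs_of_pos hθ, hθ.le]
    have h3 := abs_add_le (if z = u then θ else 0) (dotZ b z)
    have h4 := znorm_nonneg z
    have h5 : κ * θ * znorm z ≤ 1 * θ * znorm z := by gcongr
    have h6 : 0 ≤ θ * znorm z := by positivity
    simp only [hg]
    linarith
  obtain ⟨-, h2⟩ := hb g (2 * θ) hθ1 habs
  have hmean : HasSum (fun z => ν z * g z) (p * θ + κ * θ * M) := by
    have h1 : HasSum (fun z => ν z * if z = u then θ else 0) (p * θ) := by
      convert hasSum_single u fun z hz => ?_ using 1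
      · simp [p]
      · simp [hz]
    have h2 := h1.add (hasSum_mul_dotZ h.mean b)
    rw [dotR_const] at h2
    simpa only [hg, mul_add] using h2
  rw [hmean.tsum_eq] at h2
  set a : ℝ := -(θ * (1 + ε) * p)
  set x : ℝ := a + (p * θ + κ * θ * M + C * (2 * θ) ^ 2) with hx
  have hx0 : x < 0 := by
    have h1 : κ * θ * M ≤ θ * (ε * p / 4) := by nlinarith
    have h2 : C * (2 * θ) ^ 2 ≤ θ * (ε * p / 4) := by nlinarith
    have h3 : 0 < θ * (ε * p) := by positivity
    simp only [hx, a]; linarith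
  have hinv : 0 < (1 - Real.exp x)⁻¹ := by
    have := Real.exp_lt_one_iff.2 hx0; exact inv_pos.2 (by linarith)
  refine ⟨κ * θ, by positivity, p⁻¹ * (1 - Real.exp x)⁻¹, by positivity, fun y => ?_⟩
  have hcond : ∀ n k : ℕ, ENNReal.ofReal (1 + ε) * (n * toWeight ν u) < k →
      1 ≤ ENNReal.ofReal (Real.exp a) ^ n * ENNReal.ofReal (Real.exp θ) ^ k := by
    intro n k hnk
    rw [toWeight, ← ENNReal.ofReal_natCast, ← ENNReal.ofReal_natCast,
      ← ENNReal.ofReal_mul (by positivity), ← ENNReal.ofReal_mul (by positivity),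
      ENNReal.ofReal_lt_ofReal_iff_of_nonneg (by positivity)] at hnk
    rw [← ENNReal.ofReal_pow (Real.exp_pos _).le, ← ENNReal.ofReal_pow (Real.exp_pos _).le,
      ← ENNReal.ofReal_mul (by positivity), ← Real.exp_nat_mul, ← Real.exp_nat_mul, ← Real.exp_add,
      ENNReal.one_le_ofReal, Real.one_le_exp_iff]
    have := mul_le_mul_of_nonneg_left hnk.le hθ.le
    simp only [a, p]
    linarith
  refine (convGreen_sub_le (N := toWeight ν) (by simpa [toWeight] using hu)
    ENNReal.ofReal_ne_top hcond y).trans (add_le_add le_rfl ?_)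
  set w : (Fin d → ℤ) → ℝ≥0∞ := fun z => ENNReal.ofReal (Real.exp (dotZ b z)) with hw
  have hwmul : ∀ z z', w (z + z') ≤ w z * w z' := by
    intro z z'
    rw [hw]
    simp only
    rw [← ENNReal.ofReal_mul (Real.exp_pos _).le, ← Real.exp_add, dotZ_add]
  set N' : (Fin d → ℤ) → ℝ≥0∞ := fun z => toWeight ν z *
    if z = u then ENNReal.ofReal (Real.exp θ) else 1 with hN'
  have hmass : ∑' z, N' z * w z ≤
      ENNReal.ofReal (Real.exp (p * θ + κ * θ * M + C * (2 * θ) ^ 2)) := by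
    refine le_trans (le_of_eq (tsum_congr fun z => ?_)) h2
    simp only [hN', hw, hg, Real.exp_add, mul_assoc]
    rw [ENNReal.ofReal_mul (Real.exp_pos _).le]
    congr 2
    split_ifs <;> simp
  have hn : ∀ n, ENNReal.ofReal (Real.exp a) ^ n * convPow N' n y ≤
      ENNReal.ofReal (Real.exp x) ^ n * ENNReal.ofReal (Real.exp (-dotZ b y)) := by
    intro n
    have h1 := convPow_mul_le_pow (N := N') hwmul n y
    have h0 : w 0 = 1 := by simp [hw, dotZ_zero]
    rw [h0, one_mul] at h1
    have hcancel : w y * ENNReal.ofReal (Real.exp (-dotZ b y)) = 1 := by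
      rw [hw, ← ENNReal.ofReal_mul (Real.exp_pos _).le, ← Real.exp_add]; simp
    calc _ = ENNReal.ofReal (Real.exp a) ^ n * (convPow N' n y * w y) *
          ENNReal.ofReal (Real.exp (-dotZ b y)) := by
          rw [mul_assoc, mul_assoc (convPow N' n y), hcancel, mul_one]
      _ ≤ ENNReal.ofReal (Real.exp a) ^ n *
          ENNReal.ofReal (Real.exp (p * θ + κ * θ * M + C * (2 * θ) ^ 2)) ^ n *
          ENNReal.ofReal (Real.exp (-dotZ b y)) := by
          gcongr
          exact h1.trans (by gcongr)
      _ = _ := by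
          rw [← mul_pow, ← ENNReal.ofReal_mul (Real.exp_pos _).le, ← Real.exp_add]
  calc _ = (toWeight ν u)⁻¹ * ∑' n, ENNReal.ofReal (Real.exp a) ^ n * convPow N' n y := by congr!
    _ ≤ (toWeight ν u)⁻¹ * ∑' n, ENNReal.ofReal (Real.exp x) ^ n *
        ENNReal.ofReal (Real.exp (-dotZ b y)) := by
        exact mul_le_mul_right (ENNReal.tsum_le_tsum hn) _
    _ = _ := by
        rw [ENNReal.tsum_mul_right, geometric_ofReal_exp hx0, toWeight,
          ← ENNReal.ofReal_inv_of_pos hu, ← ENNReal.ofReal_mul hinv.le,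
          ← ENNReal.ofReal_mul (inv_nonneg.2 hu.le), ← mul_assoc]

end DriftLaw

end DriftLaw

section Direction

open scoped ENNReal

variable {d : ℕ} {ν : (Fin d → ℤ) → ℝ} {m : Fin d → ℝ}

/-- Distance from `y` to `n • m`. -/
noncomputable def devZ (m : Fin d → ℝ) (n : ℕ) (y : Fin d → ℤ) : ℝ := ∑ i, |(y i : ℝ) - n * m i|

/-- The filter of pairs `(n, y)` with `n → ∞` and `y / n → m`. -/
noncomputable def dirFilter (m : Fin d → ℝ) : Filter (ℕ × (Fin d → ℤ)) :=
  comap Prod.fst atTop ⊓ comap (fun p => devZ m p.1 p.2 / p.1) (𝓝 0)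

lemma devZ_nonneg (n : ℕ) (y : Fin d → ℤ) : 0 ≤ devZ m n y :=
  Finset.sum_nonneg fun _ _ => abs_nonneg _

lemma devZ_sub_le (n : ℕ) (y a : Fin d → ℤ) : devZ m n (y - a) ≤ devZ m n y + znorm a := by
  rw [devZ, devZ, znorm, ← Finset.sum_add_distrib]
  refine Finset.sum_le_sum fun i _ => ?_
  rw [Pi.sub_apply, Int.cast_sub, sub_right_comm]
  exact abs_sub _ _

lemma znorm_sub_le_devZ (n : ℕ) (y w : Fin d → ℤ) :
    znorm (y - w) ≤ devZ m n y + devZ m n w := by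
  rw [devZ, devZ, znorm, ← Finset.sum_add_distrib]
  refine Finset.sum_le_sum fun i _ => ?_
  rw [Pi.sub_apply, Int.cast_sub]
  calc |(y i : ℝ) - w i| = |(y i - n * m i) - (w i - n * m i)| := by ring_nf
    _ ≤ _ := abs_sub _ _

lemma eventually_dirFilter {P : ℕ × (Fin d → ℤ) → Prop} :
    (∀ᶠ p in dirFilter m, P p) ↔
      ∃ δ > 0, ∃ R : ℕ, ∀ n ≥ R, ∀ y, devZ m n y ≤ δ * n → P (n, y) := by
  have hb := (atTop_basis.comap (Prod.fst : ℕ × (Fin d → ℤ) → ℕ)).inf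
    ((Metric.nhds_basis_closedBall (x := (0 : ℝ))).comap
      (fun p : ℕ × (Fin d → ℤ) => devZ m p.1 p.2 / p.1))
  rw [dirFilter, hb.eventually_iff]
  have hmem : ∀ (n : ℕ) y (δ : ℝ), 0 < n → (|devZ m n y / n| ≤ δ ↔ devZ m n y ≤ δ * n) := by
    intro n y δ hn
    have hn' : (0 : ℝ) < n := by exact_mod_cast hn
    rw [abs_of_nonneg (div_nonneg (devZ_nonneg n y) hn'.le), div_le_iff₀ hn']
  constructor
  · rintro ⟨⟨R, δ⟩, ⟨-, hδ⟩, h⟩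
    refine ⟨δ, hδ, max R 1, fun n hn y hy => h ⟨le_trans (le_max_left _ _) hn, ?_⟩⟩
    have hn1 : 0 < n := lt_of_lt_of_le one_pos (le_trans (le_max_right R 1) hn)
    simpa [Real.dist_eq, abs_div] using (hmem n y δ hn1).2 hy
  · rintro ⟨δ, hδ, R, h⟩
    refine ⟨⟨max R 1, δ⟩, ⟨trivial, hδ⟩, ?_⟩
    rintro ⟨n, y⟩ ⟨hn, hy⟩
    simp only [Set.mem_preimage, Set.mem_Ici] at hn
    have hn1 : 0 < n := lt_of_lt_of_le one_pos (le_trans (le_max_right R 1) hn)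
    refine h n (le_trans (le_max_left _ _) hn) y ((hmem n y δ hn1).1 ?_)
    simpa [Real.dist_eq, abs_div] using hy

lemma tendsto_sub_dirFilter (a : Fin d → ℤ) :
    Tendsto (fun p : ℕ × (Fin d → ℤ) => (p.1, p.2 - a)) (dirFilter m) (dirFilter m) := by
  intro S hS
  obtain ⟨δ, hδ, R, h⟩ := eventually_dirFilter.1 (show ∀ᶠ p in dirFilter m, p ∈ S from hS)
  refine eventually_dirFilter.2 ⟨δ / 2, half_pos hδ, max R ⌈2 * znorm a / δ⌉₊, fun n hn y hy => ?_⟩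
  refine h n (le_trans (le_max_left _ _) hn) _ ?_
  have h1 : 2 * znorm a / δ ≤ n :=
    (Nat.le_ceil _).trans (by exact_mod_cast le_trans (le_max_right _ _) hn)
  rw [div_le_iff₀ hδ] at h1
  linarith [devZ_sub_le (m := m) n y a]

lemma tendsto_fst_dirFilter : Tendsto Prod.fst (dirFilter m) atTop :=
  tendsto_inf_left tendsto_comap

namespace DriftLaw

lemma exists_convPow_pos (h : DriftLaw ν m) (z : Fin d → ℤ) :
    ∃ k, 0 < convPow (toWeight ν) k z := by
  obtain ⟨k, c, h0, hk, -, hc⟩ := h.irred 0 trivial z trivial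
  have : ∀ j ≤ k, 0 < convPow (toWeight ν) j (c j) := by
    intro j
    induction j with
    | zero => intro _; simp [convPow, h0]
    | succ j ih =>
      intro hj
      refine lt_of_lt_of_le ?_ ((convPow_mul_le j 1 (c j) (c (j + 1) - c j)).trans_eq
        (by rw [add_sub_cancel]))
      refine ENNReal.mul_pos (ih (by omega)).ne' ?_
      rw [convPow_one, toWeight]
      exact (ENNReal.ofReal_pos.2 (hc j (by omega))).ne'
  exact ⟨k, hk ▸ this k le_rfl⟩

lemma exists_ofReal_exp_neg_le {c : ℝ≥0∞} (hc : 0 < c) :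
    ∃ b : ℝ, 0 ≤ b ∧ ENNReal.ofReal (Real.exp (-b)) ≤ c := by
  have ht : Tendsto (fun b : ℝ => ENNReal.ofReal (Real.exp (-b))) atTop (𝓝 0) := by
    have := ENNReal.tendsto_ofReal
      (Real.tendsto_exp_atBot.comp (tendsto_neg_atTop_atBot (G := ℝ)))
    simpa using this
  obtain ⟨b, hb, hb0⟩ := ((ht.eventually (ge_mem_nhds hc)).and (eventually_ge_atTop 0)).exists
  exact ⟨b, hb0, hb⟩

lemma exists_exp_le_convGreen (h : DriftLaw ν m) :
    ∃ b : ℝ, 0 ≤ b ∧ ∀ z, ENNReal.ofReal (Real.exp (-(b * znorm z))) ≤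
      convGreen (toWeight ν) z := by
  choose k hk using h.exists_convPow_pos
  choose f hf0 hf using fun z => exists_ofReal_exp_neg_le (hk z)
  obtain ⟨B, hB⟩ := (finite_isUnitStep (d := d)).image f |>.bddAbove
  refine ⟨max B 0, le_max_right _ _, fun z => ?_⟩
  suffices hz : ∃ j, ENNReal.ofReal (Real.exp (-(max B 0 * znorm z))) ≤
      convPow (toWeight ν) j z by
    obtain ⟨j, hj⟩ := hz
    exact hj.trans (ENNReal.le_tsum j)
  refine unitStep_induction (P := fun z => ∃ j, ENNReal.ofReal (Real.exp (-(max B 0 * znorm z))) ≤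
      convPow (toWeight ν) j z) ⟨0, by simp [convPow, znorm_zero]⟩ ?_ z
  rintro z e he hze ⟨j, hj⟩
  refine ⟨j + k e, le_trans ?_ (convPow_mul_le j (k e) z e)⟩
  calc ENNReal.ofReal (Real.exp (-(max B 0 * znorm (z + e))))
      ≤ ENNReal.ofReal (Real.exp (-(max B 0 * znorm z))) * ENNReal.ofReal (Real.exp (-f e)) := by
        rw [← ENNReal.ofReal_mul (Real.exp_pos _).le, ← Real.exp_add, hze]
        refine ENNReal.ofReal_le_ofReal (Real.exp_le_exp.2 ?_)
        have : f e ≤ max B 0 := (hB ⟨e, he, rfl⟩).trans (le_max_left _ _)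
        linarith
    _ ≤ _ := mul_le_mul' hj (hf e)

lemma convGreen_pos (h : DriftLaw ν m) (z : Fin d → ℤ) : 0 < convGreen (toWeight ν) z := by
  obtain ⟨b, -, hb⟩ := h.exists_exp_le_convGreen
  exact lt_of_lt_of_le (ENNReal.ofReal_pos.2 (Real.exp_pos _)) (hb z)

/-- Chernoff bound for the unrestricted walk. -/
lemma exists_tsum_convPow_exp_le (h : DriftLaw ν m) :
    ∃ s₀ > 0, ∃ C > 0, ∀ (a : Fin d → ℝ) (s : ℝ), 0 ≤ s → s ≤ s₀ → (∀ i, |a i| ≤ s) → ∀ n : ℕ,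
      ∑' w, convPow (toWeight ν) n w * ENNReal.ofReal (Real.exp (dotZ a w)) ≤
        ENNReal.ofReal (Real.exp (n * (dotR a m + C * s ^ 2))) := by
  obtain ⟨s₀, hs₀, C, hC, hb⟩ := h.exists_laplace
  refine ⟨s₀, hs₀, C, hC, fun a s hs hss ha n => ?_⟩
  obtain ⟨-, h2⟩ := hb (dotZ a) s hss fun z => (abs_dotZ_le ha z).trans (by gcongr; linarith)
  rw [(hasSum_mul_dotZ h.mean a).tsum_eq] at h2
  refine (tsum_convPow_mul_le (fun z w => ?_) n).trans ?_
  · rw [← ENNReal.ofReal_mul (Real.exp_pos _).le, ← Real.exp_add, dotZ_add]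
  · rw [Real.exp_nat_mul, ENNReal.ofReal_pow (Real.exp_pos _).le, dotZ_zero, Real.exp_zero,
      ENNReal.ofReal_one, one_mul]
    exact pow_le_pow_left' h2 n

/-- Weak law of large numbers. -/
lemma exists_half_le_tsum (h : DriftLaw ν m) {δ : ℝ} (hδ : 0 < δ) :
    ∃ R : ℕ, ∀ n ≥ R, 2⁻¹ ≤
      ∑' w, if devZ m n w ≤ δ * n then convPow (toWeight ν) n w else 0 := by
  obtain ⟨s₀, hs₀, C, hC, hb⟩ := h.exists_tsum_convPow_exp_le
  have hd : (0 : ℝ) < d := by exact_mod_cast h.dim_pos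
  obtain ⟨θ, hθ, hθ1, hθ2⟩ : ∃ θ > 0, θ ≤ s₀ ∧ C * θ ≤ δ / (2 * d) := by
    refine ⟨min s₀ (δ / (2 * d * C)), by positivity, min_le_left _ _, ?_⟩
    calc C * min s₀ (δ / (2 * d * C)) ≤ C * (δ / (2 * d * C)) := by gcongr; exact min_le_right _ _
      _ = _ := by field_simp
  set x := -(θ * (δ / (2 * d))) with hx
  have hx0 : x < 0 := by simp only [hx, neg_lt_zero]; positivity
  have hlim : Tendsto (fun n : ℕ => 2 * (d : ℝ) * Real.exp x ^ n) atTop (𝓝 0) := by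
    simpa using (tendsto_pow_atTop_nhds_zero_of_lt_one (Real.exp_pos x).le
      (Real.exp_lt_one_iff.2 hx0)).const_mul (2 * (d : ℝ))
  obtain ⟨R, hR⟩ := eventually_atTop.1 (hlim.eventually (ge_mem_nhds (show (0 : ℝ) < 2⁻¹ by norm_num)))
  refine ⟨R, fun n hn => ?_⟩
  set a : Fin d → ℝ → Fin d → ℝ := fun i t => Pi.single i t with ha
  have hdot : ∀ i t w, dotZ (a i t) w = t * w i := by
    intro i t w
    simp [dotZ, ha, Pi.single_apply]
  have hdotR : ∀ i t, dotR (a i t) m = t * m i := by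
    intro i t
    simp [dotR, ha, Pi.single_apply]
  have hone : ∀ i t, |t| = θ → ∑' w, convPow (toWeight ν) n w *
      ENNReal.ofReal (Real.exp (t * (w i - n * m i) - θ * (δ / d * n))) ≤
        ENNReal.ofReal (Real.exp x ^ n) := by
    intro i t ht
    have h1 := hb (a i t) θ hθ.le hθ1 (fun j => by
      rw [ha]
      by_cases hij : j = i
      · subst hij; simp [ht]
      · simp [hij, hθ.le]) n
    rw [hdotR] at h1
    calc _ = (∑' w, convPow (toWeight ν) n w * ENNReal.ofReal (Real.exp (dotZ (a i t) w))) *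
          ENNReal.ofReal (Real.exp (-(n * (t * m i)) - θ * (δ / d * n))) := by
          rw [← ENNReal.tsum_mul_right]
          refine tsum_congr fun w => ?_
          rw [mul_assoc, ← ENNReal.ofReal_mul (Real.exp_pos _).le, ← Real.exp_add, hdot]
          congr 3
          ring
      _ ≤ _ := mul_le_mul_left h1 _
      _ ≤ _ := by
          rw [← ENNReal.ofReal_mul (Real.exp_pos _).le, ← Real.exp_add, ← Real.exp_nat_mul]
          refine ENNReal.ofReal_le_ofReal (Real.exp_le_exp.2 ?_)
          have h3 : (n : ℝ) * θ * (C * θ) ≤ n * θ * (δ / (2 * d)) := by gcongr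
          have h4 : δ / d = 2 * (δ / (2 * d)) := by field_simp
          rw [h4, hx]
          linarith
  have hbad : ∑' w, (if devZ m n w ≤ δ * n then 0 else convPow (toWeight ν) n w) ≤ 2⁻¹ := by
    calc _ ≤ ∑' w, ∑ i, (convPow (toWeight ν) n w *
            ENNReal.ofReal (Real.exp (θ * (w i - n * m i) - θ * (δ / d * n))) +
            convPow (toWeight ν) n w *
            ENNReal.ofReal (Real.exp (-θ * (w i - n * m i) - θ * (δ / d * n)))) := by
          refine ENNReal.tsum_le_tsum fun w => ?_
          split_ifs with hw
          · exact zero_le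
          obtain ⟨i, hi⟩ : ∃ i, δ / d * n ≤ |(w i : ℝ) - n * m i| := by
            by_contra! hcon
            refine hw ((Finset.sum_le_sum fun i _ => (hcon i).le).trans_eq ?_)
            rw [Finset.sum_const, Finset.card_univ, Fintype.card_fin, nsmul_eq_mul]
            field_simp
          refine le_trans ?_ (Finset.single_le_sum (fun _ _ => zero_le) (Finset.mem_univ i))
          rw [← mul_add]
          refine le_mul_of_one_le_right (zero_le) ?_
          rcases le_abs.1 hi with hi | hi
          · refine le_trans ?_ le_self_add
            rw [ENNReal.one_le_ofReal, Real.one_le_exp_iff]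
            have := mul_le_mul_of_nonneg_left hi hθ.le
            linarith
          · refine le_trans ?_ le_add_self
            rw [ENNReal.one_le_ofReal, Real.one_le_exp_iff]
            have := mul_le_mul_of_nonneg_left hi hθ.le
            linarith
      _ = ∑ i : Fin d, ∑' w, (convPow (toWeight ν) n w *
            ENNReal.ofReal (Real.exp (θ * (w i - n * m i) - θ * (δ / d * n))) +
            convPow (toWeight ν) n w *
            ENNReal.ofReal (Real.exp (-θ * (w i - n * m i) - θ * (δ / d * n)))) :=
          Summable.tsum_finsetSum fun _ _ => ENNReal.summable
      _ ≤ ∑ i : Fin d, (ENNReal.ofReal (Real.exp x ^ n) + ENNReal.ofReal (Real.exp x ^ n)) := by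
          refine Finset.sum_le_sum fun i _ => ?_
          rw [ENNReal.tsum_add]
          exact add_le_add (hone i θ (abs_of_pos hθ)) (hone i (-θ) (by rw [abs_neg, abs_of_pos hθ]))
      _ = ENNReal.ofReal (2 * (d : ℝ) * Real.exp x ^ n) := by
          rw [Finset.sum_const, Finset.card_univ, Fintype.card_fin, nsmul_eq_mul,
            ← ENNReal.ofReal_add (by positivity) (by positivity), ← ENNReal.ofReal_natCast,
            ← ENNReal.ofReal_mul hd.le]
          congr 1; ring
      _ ≤ ENNReal.ofReal 2⁻¹ := ENNReal.ofReal_le_ofReal (hR n hn)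
      _ = 2⁻¹ := by rw [ENNReal.ofReal_inv_of_pos two_pos]; simp
  have htot := tsum_convPow h.tsum_weight n
  have hsplit : (∑' w, if devZ m n w ≤ δ * n then convPow (toWeight ν) n w else 0) +
      ∑' w, (if devZ m n w ≤ δ * n then 0 else convPow (toWeight ν) n w) = 1 := by
    rw [← ENNReal.tsum_add, ← htot]
    refine tsum_congr fun w => ?_
    split_ifs <;> simp
  by_contra! hcon
  refine absurd hsplit (ne_of_lt ?_)
  calc _ < (2⁻¹ : ℝ≥0∞) + 2⁻¹ := ENNReal.add_lt_add_of_lt_of_le (ne_top_of_le_ne_top (by simp) hbad)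
        hcon hbad
    _ = 1 := ENNReal.inv_two_add_inv_two

/-- Along the drift direction the Green function does not decay exponentially. -/
lemma eventually_exp_le_convGreen (h : DriftLaw ν m) {ε : ℝ} (hε : 0 < ε) :
    ∀ᶠ p in dirFilter m,
      ENNReal.ofReal (Real.exp (-(ε * p.1))) ≤ convGreen (toWeight ν) p.2 := by
  obtain ⟨b, hb, hG⟩ := h.exists_exp_le_convGreen
  obtain ⟨δ, hδ, hδε⟩ : ∃ δ > 0, b * (2 * δ) ≤ ε / 2 := by
    refine ⟨ε / (4 * (b + 1)), by positivity, ?_⟩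
    rw [show b * (2 * (ε / (4 * (b + 1)))) = (ε / 2) * (b / (b + 1)) by field_simp; ring]
    exact mul_le_of_le_one_right (by positivity) ((div_le_one (by positivity)).2 (by linarith))
  obtain ⟨R, hR⟩ := h.exists_half_le_tsum hδ
  refine eventually_dirFilter.2 ⟨δ, hδ, max R ⌈2 / ε⌉₊, fun n hn y hy => ?_⟩
  have hn2 : 2 / ε ≤ n := (Nat.le_ceil _).trans (by exact_mod_cast le_trans (le_max_right _ _) hn)
  rw [div_le_iff₀ hε] at hn2
  calc ENNReal.ofReal (Real.exp (-(ε * n)))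
      ≤ 2⁻¹ * ENNReal.ofReal (Real.exp (-(b * (2 * δ * n)))) := by
        rw [← ENNReal.ofReal_ofNat 2, ← ENNReal.ofReal_inv_of_pos two_pos,
          ← ENNReal.ofReal_mul (by norm_num)]
        refine ENNReal.ofReal_le_ofReal ?_
        have h1 : -(ε * n) ≤ -(b * (2 * δ * n)) + -1 := by
          have : b * (2 * δ) * n ≤ ε / 2 * n := by gcongr
          linarith
        refine (Real.exp_le_exp.2 h1).trans ?_
        rw [Real.exp_add, mul_comm]
        gcongr
        rw [Real.exp_neg]
        refine inv_anti₀ two_pos ?_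
        linarith [Real.add_one_le_exp 1]
    _ ≤ (∑' w, if devZ m n w ≤ δ * n then convPow (toWeight ν) n w else 0) *
        ENNReal.ofReal (Real.exp (-(b * (2 * δ * n)))) :=
        mul_le_mul_left (hR n (le_trans (le_max_left _ _) hn)) _
    _ ≤ ∑' w, convPow (toWeight ν) n w * convGreen (toWeight ν) (y - w) := by
        rw [← ENNReal.tsum_mul_right]
        refine ENNReal.tsum_le_tsum fun w => ?_
        split_ifs with hw
        · refine mul_le_mul_right (le_trans ?_ (hG (y - w))) _
          refine ENNReal.ofReal_le_ofReal (Real.exp_le_exp.2 (neg_le_neg ?_))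
          refine mul_le_mul_of_nonneg_left ?_ hb
          linarith [znorm_sub_le_devZ (m := m) n y w]
        · simp
    _ ≤ _ := tsum_convPow_mul_convGreen_le n y

end DriftLaw

end Direction

section Ratio

open scoped ENNReal

variable {d : ℕ} {ν : (Fin d → ℤ) → ℝ} {m : Fin d → ℝ}

namespace DriftLaw

lemma eventually_le_dotZ_const (h : DriftLaw ν m) {c : ℝ} (hc : 0 < c) :
    ∀ᶠ p in dirFilter m, c * ((∑ i, m i) / 2 * p.1) ≤ dotZ (fun _ => c) p.2 := by
  have hM := h.sum_mean_pos
  refine eventually_dirFilter.2 ⟨(∑ i, m i) / 2, by positivity, 0, fun n _ y hy => ?_⟩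
  simp only [dotZ, ← Finset.mul_sum]
  refine mul_le_mul_of_nonneg_left ?_ hc.le
  have h1 : n * ∑ i, m i - ∑ i, (y i : ℝ) ≤ devZ m n y := by
    rw [Finset.mul_sum, ← Finset.sum_sub_distrib, devZ]
    refine Finset.sum_le_sum fun i _ => ?_
    rw [abs_sub_comm]
    exact le_abs_self _
  linarith

/-- Asymptotic invariance of the Green function under translation by `z`. -/
def SlowAlong (ν : (Fin d → ℤ) → ℝ) (m : Fin d → ℝ) (z : Fin d → ℤ) : Prop :=
  ∀ ε > 0, ∀ᶠ p in dirFilter m, convGreen (toWeight ν) (p.2 - z) ≤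
    ENNReal.ofReal (Real.exp ε) * convGreen (toWeight ν) p.2

lemma slowAlong_step (h : DriftLaw ν m) {u : Fin d → ℤ} (hu : 0 < ν u) : SlowAlong ν m u := by
  intro ε hε
  obtain ⟨c, hc, K, hK, hstep⟩ := h.exists_convGreen_sub_step_le hu (half_pos hε)
  have hM := h.sum_mean_pos
  set M := ∑ i, m i
  have hlim : Tendsto (fun n : ℕ => K * Real.exp (-(c * M / 4)) ^ n) atTop (𝓝 0) := by
    simpa using (tendsto_pow_atTop_nhds_zero_of_lt_one (Real.exp_pos _).le
      (Real.exp_lt_one_iff.2 (neg_lt_zero.2 (show 0 < c * M / 4 by positivity)))).const_mul K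
  filter_upwards [h.eventually_exp_le_convGreen (show 0 < c * M / 4 by positivity),
    h.eventually_le_dotZ_const hc,
    tendsto_fst_dirFilter.eventually (hlim.eventually (ge_mem_nhds (half_pos hε)))]
    with p h1 h2 h3
  calc _ ≤ _ := hstep p.2
    _ ≤ ENNReal.ofReal (1 + ε / 2) * convGreen (toWeight ν) p.2 +
        ENNReal.ofReal (ε / 2) * convGreen (toWeight ν) p.2 := by
        refine add_le_add le_rfl (le_trans ?_ (mul_le_mul_right h1 _))
        rw [← ENNReal.ofReal_mul (by positivity)]
        refine ENNReal.ofReal_le_ofReal ?_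
        calc K * Real.exp (-dotZ (fun _ => c) p.2)
            ≤ K * (Real.exp (-(c * M / 4)) ^ p.1 * Real.exp (-(c * M / 4 * p.1))) := by
              rw [← Real.exp_nat_mul, ← Real.exp_add]
              refine mul_le_mul_of_nonneg_left (Real.exp_le_exp.2 ?_) hK.le
              linarith
          _ ≤ _ := by rw [← mul_assoc]; exact mul_le_mul_of_nonneg_right h3 (Real.exp_pos _).le
    _ = ENNReal.ofReal (1 + ε) * convGreen (toWeight ν) p.2 := by
        rw [← add_mul, ← ENNReal.ofReal_add (by positivity) (by positivity)]
        congr 2; ring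
    _ ≤ _ := mul_le_mul_left (ENNReal.ofReal_le_ofReal (by linarith [Real.add_one_le_exp ε])) _

lemma slowAlong_zero : SlowAlong ν m 0 := by
  intro ε hε
  refine Eventually.of_forall fun p => ?_
  rw [sub_zero]
  refine le_mul_of_one_le_left zero_le ?_
  rw [ENNReal.one_le_ofReal, Real.one_le_exp_iff]
  exact hε.le

lemma SlowAlong.add {a b : Fin d → ℤ} (ha : SlowAlong ν m a) (hb : SlowAlong ν m b) :
    SlowAlong ν m (a + b) := by
  intro ε hε
  filter_upwards [ha (ε / 2) (half_pos hε),
    (tendsto_sub_dirFilter a).eventually (hb (ε / 2) (half_pos hε))] with p h1 h2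
  rw [← sub_sub]
  calc _ ≤ _ := h2
    _ ≤ _ := mul_le_mul_right h1 _
    _ = _ := by
      rw [← mul_assoc, ← ENNReal.ofReal_mul (Real.exp_pos _).le, ← Real.exp_add, add_halves]

lemma slowAlong (h : DriftLaw ν m) (z : Fin d → ℤ) : SlowAlong ν m z := by
  obtain ⟨k, c, h0, hk, -, hc⟩ := h.irred 0 trivial z trivial
  have : ∀ j ≤ k, SlowAlong ν m (c j) := by
    intro j
    induction j with
    | zero => intro _; rw [h0]; exact slowAlong_zero
    | succ j ih =>
      intro hj
      have := (ih (by omega)).add (h.slowAlong_step (hc j (by omega)))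
      rwa [add_sub_cancel] at this
  exact hk ▸ this k le_rfl

/-- The Green function is locally of slow exponential growth near the drift direction. -/
lemma exists_convGreen_sub_le (h : DriftLaw ν m) {ε : ℝ} (hε : 0 < ε) :
    ∃ δ > 0, ∃ R : ℕ, ∀ n ≥ R, ∀ y, devZ m n y ≤ δ * n → ∀ z, znorm z ≤ δ * n →
      convGreen (toWeight ν) (y - z) ≤
        ENNReal.ofReal (Real.exp (ε * znorm z)) * convGreen (toWeight ν) y := by
  have hev : ∀ᶠ p in dirFilter m, ∀ e ∈ {e : Fin d → ℤ | IsUnitStep e},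
      convGreen (toWeight ν) (p.2 - e) ≤
        ENNReal.ofReal (Real.exp ε) * convGreen (toWeight ν) p.2 :=
    (eventually_all_finite finite_isUnitStep).2 fun e _ => h.slowAlong e ε hε
  obtain ⟨δ, hδ, R, hR⟩ := eventually_dirFilter.1 hev
  refine ⟨δ / 2, half_pos hδ, R, fun n hn y hy z => ?_⟩
  refine unitStep_induction (P := fun z => znorm z ≤ δ / 2 * n → convGreen (toWeight ν) (y - z) ≤
        ENNReal.ofReal (Real.exp (ε * znorm z)) * convGreen (toWeight ν) y) ?_ ?_ z
  · intro _; simp [znorm_zero]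
  · intro z e he hze ih hz
    rw [hze] at hz
    have hz' : znorm z ≤ δ / 2 * n := by linarith
    have h1 := hR n hn (y - z) (by linarith [devZ_sub_le (m := m) n y z]) e he
    rw [← sub_sub]
    calc _ ≤ _ := h1
      _ ≤ _ := mul_le_mul_right (ih hz') _
      _ = _ := by
        rw [← mul_assoc, ← ENNReal.ofReal_mul (Real.exp_pos _).le, ← Real.exp_add, hze]
        congr 3; ring

lemma tendsto_convGreen_sub_div (h : DriftLaw ν m) (z : Fin d → ℤ) :
    Tendsto (fun p : ℕ × (Fin d → ℤ) =>
      convGreen (toWeight ν) (p.2 - z) / convGreen (toWeight ν) p.2) (dirFilter m) (𝓝 1) := by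
  have hlow : ∀ ε > 0, ∀ᶠ p in dirFilter m, ENNReal.ofReal (Real.exp (-ε)) ≤
      convGreen (toWeight ν) (p.2 - z) / convGreen (toWeight ν) p.2 := by
    intro ε hε
    filter_upwards [(tendsto_sub_dirFilter z).eventually (h.slowAlong (-z) ε hε)] with p hp
    rw [sub_neg_eq_add, sub_add_cancel] at hp
    rw [ENNReal.le_div_iff_mul_le (Or.inl (h.convGreen_pos _).ne') (Or.inl (h.convGreen_ne_top _))]
    refine (mul_le_mul_right hp _).trans (le_of_eq ?_)
    rw [← mul_assoc, ← ENNReal.ofReal_mul (Real.exp_pos _).le, ← Real.exp_add]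
    simp
  have hup : ∀ ε > 0, ∀ᶠ p in dirFilter m, convGreen (toWeight ν) (p.2 - z) /
      convGreen (toWeight ν) p.2 ≤ ENNReal.ofReal (Real.exp ε) := by
    intro ε hε
    filter_upwards [h.slowAlong z ε hε] with p hp
    exact ENNReal.div_le_of_le_mul hp
  have hc : Tendsto (fun ε : ℝ => ENNReal.ofReal (Real.exp ε)) (𝓝 0) (𝓝 1) := by
    have := (ENNReal.continuous_ofReal.comp Real.continuous_exp).tendsto (0 : ℝ)
    simpa [Function.comp_def] using this
  have hc' : Tendsto (fun ε : ℝ => ENNReal.ofReal (Real.exp (-ε))) (𝓝 0) (𝓝 1) := by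
    have := (ENNReal.continuous_ofReal.comp (Real.continuous_exp.comp continuous_neg)).tendsto (0 : ℝ)
    simpa [Function.comp_def] using this
  refine tendsto_order.2 ⟨fun a ha => ?_, fun a ha => ?_⟩
  · obtain ⟨ε, h1, hε⟩ := (((hc'.mono_left nhdsWithin_le_nhds).eventually (lt_mem_nhds ha)).and
      (self_mem_nhdsWithin (s := Set.Ioi (0 : ℝ)))).exists
    exact (hlow ε hε).mono fun p hp => lt_of_lt_of_le h1 hp
  · obtain ⟨ε, h1, hε⟩ := (((hc.mono_left nhdsWithin_le_nhds).eventually (gt_mem_nhds ha)).and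
      (self_mem_nhdsWithin (s := Set.Ioi (0 : ℝ)))).exists
    exact (hup ε hε).mono fun p hp => lt_of_le_of_lt hp h1

end DriftLaw

end Ratio

section Exit

open scoped ENNReal

lemma tendsto_tsum_ennreal_of_dominated {ι α : Type*} {l : Filter ι} [l.IsCountablyGenerated]
    {f : ι → α → ℝ≥0∞} {g bound : α → ℝ≥0∞} (hb : ∀ᶠ i in l, ∀ a, f i a ≤ bound a)
    (hfin : ∑' a, bound a ≠ ∞) (hlim : ∀ a, Tendsto (fun i => f i a) l (𝓝 (g a))) :
    Tendsto (fun i => ∑' a, f i a) l (𝓝 (∑' a, g a)) := by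
  let _ : MeasurableSpace α := ⊤
  have := MeasureTheory.tendsto_lintegral_filter_of_dominated_convergence
    (μ := MeasureTheory.Measure.count) (l := l) (F := f) (f := g) bound
    (Eventually.of_forall fun _ => Measurable.of_discrete)
    (hb.mono fun _ h => Eventually.of_forall h)
    (by rwa [MeasureTheory.lintegral_count]) (Eventually.of_forall hlim)
  simpa only [MeasureTheory.lintegral_count] using this

variable {d : ℕ} {ν : (Fin d → ℤ) → ℝ} {m : Fin d → ℝ}

instance : (dirFilter m).IsCountablyGenerated := by
  unfold dirFilter; infer_instance

instance : (dirFilter m).NeBot := by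
  by_contra hcon
  rw [not_neBot] at hcon
  have hfalse : ∀ᶠ p in dirFilter m, False := by rw [hcon]; exact eventually_bot
  obtain ⟨δ, hδ, R, h⟩ := eventually_dirFilter.1 hfalse
  set n := max R ⌈d / δ⌉₊
  refine h n (le_max_left _ _) (fun i => ⌊n * m i⌋) ?_
  have h1 : d / δ ≤ n := (Nat.le_ceil _).trans (by exact_mod_cast le_max_right _ _)
  rw [div_le_iff₀ hδ] at h1
  calc devZ m n (fun i => ⌊n * m i⌋) ≤ ∑ _i : Fin d, (1 : ℝ) := by
        refine Finset.sum_le_sum fun i _ => ?_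
        rw [abs_le]
        constructor <;> linarith [Int.floor_le (n * m i), Int.lt_floor_add_one (n * m i)]
    _ = d := by simp
    _ ≤ _ := by linarith

lemma devZ_zero_le (n : ℕ) (y : Fin d → ℤ) : znorm y ≤ devZ m n y + n * ∑ i, |m i| := by
  rw [znorm, devZ, Finset.mul_sum, ← Finset.sum_add_distrib]
  refine Finset.sum_le_sum fun i _ => ?_
  calc |(y i : ℝ)| = |((y i : ℝ) - n * m i) + n * m i| := by ring_nf
    _ ≤ |(y i : ℝ) - n * m i| + |n * m i| := abs_add_le _ _
    _ = _ := by rw [abs_mul, Nat.abs_cast]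

namespace DriftLaw

/-- Uniform domination of the shifted Green function. -/
lemma eventually_convGreen_sub_le (h : DriftLaw ν m) {c : ℝ} (hc : 0 < c) :
    ∃ C : ℝ, ∀ᶠ p in dirFilter m, ∀ z, convGreen (toWeight ν) (p.2 - z) ≤
      ENNReal.ofReal (C * Real.exp (c * znorm z)) * convGreen (toWeight ν) p.2 := by
  obtain ⟨δ, hδ, R, hnear⟩ := h.exists_convGreen_sub_le hc
  have hm : 0 ≤ ∑ i, |m i| := Finset.sum_nonneg fun _ _ => abs_nonneg _
  set L := δ + ∑ i, |m i| with hL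
  have hL0 : 0 < L := by positivity
  obtain ⟨θ, hθ, hθ1, hθ2⟩ : ∃ θ > 0, θ ≤ c / 3 ∧ θ * L ≤ c / 3 * δ := by
    refine ⟨min (c / 3) (c / 3 * δ / L), by positivity, min_le_left _ _, ?_⟩
    calc min (c / 3) (c / 3 * δ / L) * L ≤ c / 3 * δ / L * L := by
          gcongr; exact min_le_right _ _
      _ = _ := by field_simp
  obtain ⟨K, hK, hG⟩ := h.exists_convGreen_le hθ
  have hnear' : ∀ᶠ p in dirFilter m, devZ m p.1 p.2 ≤ δ * p.1 ∧ R ≤ p.1 :=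
    eventually_dirFilter.2 ⟨δ, hδ, R, fun n hn y hy => ⟨hy, hn⟩⟩
  refine ⟨K + 1, ?_⟩
  filter_upwards [hnear', h.eventually_exp_le_convGreen (show 0 < c / 3 * δ by positivity)]
    with ⟨n, y⟩ ⟨hdev, hn⟩ hlow z
  simp only at hdev hn hlow ⊢
  rcases le_or_gt (znorm z) (δ * n) with hz | hz
  · refine (hnear n hn y hdev z hz).trans (mul_le_mul_left (ENNReal.ofReal_le_ofReal ?_) _)
    exact le_mul_of_one_le_left (Real.exp_pos _).le (by linarith)
  · refine (hG (y - z)).trans ?_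
    refine le_trans ?_ (mul_le_mul_right hlow _)
    rw [← ENNReal.ofReal_mul (by positivity), mul_assoc, ← Real.exp_add]
    refine ENNReal.ofReal_le_ofReal (mul_le_mul (by linarith) (Real.exp_le_exp.2 ?_)
      (Real.exp_pos _).le (by linarith))
    have h1 : znorm (y - z) ≤ L * n + znorm z := by
      have := znorm_sub_le y z
      have := devZ_zero_le (m := m) n y
      rw [hL]
      linarith
    have h2 : θ * znorm (y - z) ≤ θ * (L * n + znorm z) := mul_le_mul_of_nonneg_left h1 hθ.le
    have h3 : θ * L * n ≤ c / 3 * δ * n := mul_le_mul_of_nonneg_right hθ2 n.cast_nonneg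
    have h4 : c / 3 * (δ * n) ≤ c / 3 * znorm z := by
      exact mul_le_mul_of_nonneg_left hz.le (by positivity)
    have h5 : θ * znorm z ≤ c / 3 * znorm z := mul_le_mul_of_nonneg_right hθ1 (znorm_nonneg z)
    linarith

/-- Asymptotics of the killed Green function relative to the unrestricted one. -/
lemma tendsto_tsum_kernE_div (h : DriftLaw ν m) {A : Set (Fin d → ℤ)} {x : Fin d → ℤ} (hx : x ∈ A)
    {c : ℝ} (hc : 0 < c) (hfin : ∑' z, exitDist (toWeight ν) A x z *
      ENNReal.ofReal (Real.exp (c * znorm z)) ≠ ∞) :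
    ∑' z, exitDist (toWeight ν) A x z ≤ 1 ∧
    Tendsto (fun p : ℕ × (Fin d → ℤ) =>
      (∑' n, kernE (toWeight ν) A n x p.2) / convGreen (toWeight ν) p.2) (dirFilter m)
      (𝓝 (1 - ∑' z, exitDist (toWeight ν) A x z)) := by
  set G := convGreen (toWeight ν) with hG
  obtain ⟨C, hC⟩ := h.eventually_convGreen_sub_le hc
  have hS : Tendsto (fun p : ℕ × (Fin d → ℤ) =>
      ∑' z, exitDist (toWeight ν) A x z * (G (p.2 - z) / G p.2)) (dirFilter m)
      (𝓝 (∑' z, exitDist (toWeight ν) A x z)) := by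
    refine tendsto_tsum_ennreal_of_dominated (bound := fun z => exitDist (toWeight ν) A x z *
      ENNReal.ofReal (Real.exp (c * znorm z)) * ENNReal.ofReal C) ?_ ?_ fun z => ?_
    · filter_upwards [hC] with p hp z
      rw [mul_assoc]
      refine mul_le_mul_right (ENNReal.div_le_of_le_mul ((hp z).trans_eq ?_)) _
      rw [mul_comm C, ENNReal.ofReal_mul (Real.exp_pos _).le]
    · rw [ENNReal.tsum_mul_right]
      exact ENNReal.mul_ne_top hfin ENNReal.ofReal_ne_top
    · have := ENNReal.Tendsto.const_mul (a := exitDist (toWeight ν) A x z)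
        (h.tendsto_convGreen_sub_div z) (Or.inl one_ne_zero)
      rwa [mul_one] at this
  have heq : ∀ p : ℕ × (Fin d → ℤ), G (p.2 - x) / G p.2 =
      (∑' n, kernE (toWeight ν) A n x p.2) / G p.2 +
        ∑' z, exitDist (toWeight ν) A x z * (G (p.2 - z) / G p.2) := by
    intro p
    rw [hG, convGreen_eq hx, ENNReal.add_div]
    congr 1
    simp only [div_eq_mul_inv, ← mul_assoc, ENNReal.tsum_mul_right]
  have hle : ∀ p : ℕ × (Fin d → ℤ), ∑' z, exitDist (toWeight ν) A x z * (G (p.2 - z) / G p.2) ≤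
      G (p.2 - x) / G p.2 := fun p => by rw [heq p]; exact le_add_self
  refine ⟨le_of_tendsto_of_tendsto hS (h.tendsto_convGreen_sub_div x) (Eventually.of_forall hle), ?_⟩
  have hsub := ENNReal.Tendsto.sub (h.tendsto_convGreen_sub_div x) hS (Or.inl ENNReal.one_ne_top)
  refine hsub.congr fun p => ?_
  have hne : ∑' z, exitDist (toWeight ν) A x z * (G (p.2 - z) / G p.2) ≠ ∞ :=
    ne_top_of_le_ne_top (ENNReal.div_ne_top (h.convGreen_ne_top _) (h.convGreen_pos _).ne') (hle p)
  rw [heq p, ENNReal.add_sub_cancel_right hne]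

/-- Exponential moment of the exit position from the orthant. -/
lemma exists_tsum_exitDist_mul_exp_le (h : DriftLaw ν m) :
    ∃ c : ℝ, 0 < c ∧ ∃ θ : ℝ, 0 < θ ∧ c * d < θ ∧ ∃ K > 0, ∀ x : Fin d → ℤ,
      ∑' z, exitDist (toWeight ν) posAll x z * ENNReal.ofReal (Real.exp (c * znorm z)) ≤
        ENNReal.ofReal (∑ i, K * Real.exp (c * znorm x - θ * x i)) := by
  obtain ⟨s₀, hs₀, C, hC, hb⟩ := h.exists_laplace
  have hne : Nonempty (Fin d) := ⟨⟨0, h.dim_pos⟩⟩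
  obtain ⟨μ₀, hμ₀, hμ₀m⟩ : ∃ μ₀ > 0, ∀ i, μ₀ ≤ m i := by
    obtain ⟨i₀, -, hi₀⟩ := Finset.exists_min_image Finset.univ m Finset.univ_nonempty
    exact ⟨m i₀, h.mean_pos i₀, fun i => hi₀ i (Finset.mem_univ i)⟩
  have hsumm : Summable fun z => ν z * znorm z := by
    have := (hb (fun z => s₀ * znorm z) s₀ le_rfl fun z => by
      rw [abs_of_nonneg (mul_nonneg hs₀.le (znorm_nonneg z))]; gcongr; linarith).1
    refine (this.mul_left s₀⁻¹).congr fun z => ?_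
    field_simp
  set B := ∑' z, ν z * znorm z with hB
  have hB0 : 0 ≤ B := tsum_nonneg fun z => mul_nonneg (h.nonneg z) (znorm_nonneg z)
  obtain ⟨κ, hκ, hκ1, hκ2, hκ3⟩ : ∃ κ : ℝ, 0 < κ ∧ κ ≤ 1 ∧ κ * d < 1 ∧ κ * B ≤ μ₀ / 2 := by
    refine ⟨min (1 / (2 * d + 1)) (μ₀ / (2 * (B + 1))), by positivity, ?_, ?_, ?_⟩
    · refine (min_le_left _ _).trans ((div_le_one (by positivity)).2 ?_)
      linarith [d.cast_nonneg (α := ℝ)]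
    · calc _ ≤ 1 / (2 * d + 1) * (d : ℝ) := by gcongr; exact min_le_left _ _
        _ < 1 := by
          rw [div_mul_eq_mul_div, one_mul, div_lt_one (by positivity)]
          linarith [d.cast_nonneg (α := ℝ)]
    · calc _ ≤ μ₀ / (2 * (B + 1)) * B := by gcongr; exact min_le_right _ _
        _ = μ₀ / 2 * (B / (B + 1)) := by field_simp
        _ ≤ _ := mul_le_of_le_one_right (by positivity) ((div_le_one (by positivity)).2 (by linarith))
  obtain ⟨θ, hθ, hθ1, hθ2⟩ : ∃ θ > 0, 2 * θ ≤ s₀ ∧ 4 * C * θ ≤ μ₀ / 4 := by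
    refine ⟨min (s₀ / 2) (μ₀ / (16 * C)), by positivity, ?_, ?_⟩
    · linarith [min_le_left (s₀ / 2) (μ₀ / (16 * C))]
    · calc 4 * C * min (s₀ / 2) (μ₀ / (16 * C)) ≤ 4 * C * (μ₀ / (16 * C)) := by
            gcongr; exact min_le_right _ _
        _ = _ := by field_simp; ring
  set c := κ * θ with hcdef
  have hc : 0 < c := by positivity
  set x := -(θ * μ₀ / 4) with hx
  have hx0 : x < 0 := by simp only [hx, neg_lt_zero]; positivity
  set W : Fin d → (Fin d → ℤ) → ℝ≥0∞ := fun i z =>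
    ENNReal.ofReal (Real.exp (c * znorm z - θ * z i)) with hW
  have hWmul : ∀ i a b, W i (a + b) ≤ W i a * W i b := by
    intro i a b
    simp only [hW]
    rw [← ENNReal.ofReal_mul (Real.exp_pos _).le, ← Real.exp_add]
    refine ENNReal.ofReal_le_ofReal (Real.exp_le_exp.2 ?_)
    have := mul_le_mul_of_nonneg_left (znorm_add_le a b) hc.le
    push_cast [Pi.add_apply]
    linarith
  have hmass : ∀ i, ∑' z, toWeight ν z * W i z ≤ ENNReal.ofReal (Real.exp x) := by
    intro i
    have habs : ∀ z : Fin d → ℤ, |c * znorm z - θ * z i| ≤ 2 * θ * (1 + znorm z) := by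
      intro z
      have h1 := abs_sub (c * znorm z) (θ * z i)
      rw [abs_of_nonneg (mul_nonneg hc.le (znorm_nonneg z)), abs_mul, abs_of_pos hθ] at h1
      have h2 := mul_le_mul_of_nonneg_left (abs_apply_le_znorm z i) hθ.le
      have h3 : κ * θ * znorm z ≤ 1 * θ * znorm z := by
        have := znorm_nonneg z
        gcongr
      rw [hcdef] at h1 ⊢
      linarith
    have h1 := (hb _ (2 * θ) hθ1 habs).2
    have h2 : HasSum (fun z => ν z * (c * znorm z - θ * z i)) (c * B - θ * m i) := by
      have := (hsumm.hasSum.mul_left c).sub ((h.mean i).mul_left θ)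
      have heq : (fun z => ν z * (c * znorm z - θ * z i)) =
          fun z => c * (ν z * znorm z) - θ * (ν z * z i) := funext fun z => by ring
      rwa [heq]
    rw [h2.tsum_eq] at h1
    refine h1.trans (ENNReal.ofReal_le_ofReal (Real.exp_le_exp.2 ?_))
    have h3 : κ * B * θ ≤ μ₀ / 2 * θ := by gcongr
    have h4 : θ * μ₀ ≤ θ * m i := by gcongr; exact hμ₀m i
    have h5 : 4 * C * θ * θ ≤ μ₀ / 4 * θ := by gcongr
    rw [hcdef, hx]
    nlinarith
  have hinv : 0 < (1 - Real.exp x)⁻¹ := by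
    have := Real.exp_lt_one_iff.2 hx0; exact inv_pos.2 (by linarith)
  refine ⟨c, hc, θ, hθ, by rw [hcdef]; nlinarith, (1 - Real.exp x)⁻¹, hinv, fun y => ?_⟩
  have hW0 : ∀ i, W i 0 = 1 := fun i => by simp [hW, znorm_zero]
  have hone : ∀ i, ∑' z, (∑' n, convPow (toWeight ν) (n + 1) (z - y)) * W i z ≤
      ENNReal.ofReal ((1 - Real.exp x)⁻¹ * Real.exp (c * znorm y - θ * y i)) := by
    intro i
    calc _ = ∑' n, ∑' z, convPow (toWeight ν) (n + 1) (z - y) * W i z := by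
          simp only [← ENNReal.tsum_mul_right]
          exact ENNReal.tsum_comm
      _ ≤ ∑' n : ℕ, ENNReal.ofReal (Real.exp x) ^ n * W i y := by
          refine ENNReal.tsum_le_tsum fun n => ?_
          calc _ = ∑' z, convPow (toWeight ν) (n + 1) z * W i (z + y) := by
                rw [← (Equiv.addRight y).tsum_eq]
                simp
            _ ≤ (∑' z, convPow (toWeight ν) (n + 1) z * W i z) * W i y := by
                rw [← ENNReal.tsum_mul_right]
                refine ENNReal.tsum_le_tsum fun z => ?_
                rw [mul_assoc]
                exact mul_le_mul_right (hWmul i z y) _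
            _ ≤ _ := by
                refine mul_le_mul_left ((tsum_convPow_mul_le (hWmul i) (n + 1)).trans ?_) _
                rw [hW0, one_mul]
                refine (pow_le_pow_left' (hmass i) _).trans ?_
                rw [pow_succ]
                refine mul_le_of_le_one_right zero_le ?_
                rw [ENNReal.ofReal_le_one]
                exact (Real.exp_lt_one_iff.2 hx0).le
      _ = _ := by
          rw [ENNReal.tsum_mul_right, geometric_ofReal_exp hx0, ← ENNReal.ofReal_mul hinv.le]
  calc ∑' z, exitDist (toWeight ν) posAll y z * ENNReal.ofReal (Real.exp (c * znorm z))
      ≤ ∑' z, ∑ i, (∑' n, convPow (toWeight ν) (n + 1) (z - y)) * W i z := by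
        refine ENNReal.tsum_le_tsum fun z => ?_
        by_cases hz : z ∈ posAll
        · simp [exitDist, exitAt_of_mem _ _ hz]
        obtain ⟨i, hi⟩ : ∃ i, z i ≤ 0 := by simpa [posAll] using hz
        refine le_trans ?_ (Finset.single_le_sum (fun _ _ => zero_le) (Finset.mem_univ i))
        refine mul_le_mul' (ENNReal.tsum_le_tsum fun n => exitAt_le_convPow n y z) ?_
        refine ENNReal.ofReal_le_ofReal (Real.exp_le_exp.2 ?_)
        have hi' : (z i : ℝ) ≤ 0 := by exact_mod_cast hi
        nlinarith
    _ = ∑ i, ∑' z, (∑' n, convPow (toWeight ν) (n + 1) (z - y)) * W i z :=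
        Summable.tsum_finsetSum fun _ _ => ENNReal.summable
    _ ≤ ∑ i, ENNReal.ofReal ((1 - Real.exp x)⁻¹ * Real.exp (c * znorm y - θ * y i)) :=
        Finset.sum_le_sum fun i _ => hone i
    _ = _ := (ENNReal.ofReal_sum_of_nonneg fun i _ => by positivity).symm

/-- The walk has a positive probability to stay in the orthant forever. -/
lemma tsum_exitDist_lt_one (h : DriftLaw ν m) (hirr : Irred ν posAll) {x : Fin d → ℤ}
    (hx : x ∈ posAll) : ∑' z, exitDist (toWeight ν) posAll x z < 1 := by
  obtain ⟨c, hc, θ, hθ, hcθ, K, hK, hexit⟩ := h.exists_tsum_exitDist_mul_exp_le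
  have hle : ∀ y ∈ posAll, ∑' z, exitDist (toWeight ν) posAll y z ≤ 1 := fun y hy =>
    (h.tendsto_tsum_kernE_div hy hc (ne_top_of_le_ne_top ENNReal.ofReal_ne_top (hexit y))).1
  obtain ⟨T, hT0, hT⟩ : ∃ T : ℕ, 0 < T ∧
      ∑' z, exitDist (toWeight ν) posAll (fun _ => (T : ℤ)) z < 1 := by
    have hlim : Tendsto (fun T : ℕ => d * K * Real.exp (-(θ - c * d)) ^ T) atTop (𝓝 0) := by
      simpa using (tendsto_pow_atTop_nhds_zero_of_lt_one (Real.exp_pos _).le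
        (Real.exp_lt_one_iff.2 (neg_lt_zero.2 (sub_pos.2 hcθ)))).const_mul (d * K)
    obtain ⟨T, hT, hT0⟩ := ((hlim.eventually (gt_mem_nhds one_pos)).and
      (eventually_gt_atTop 0)).exists
    refine ⟨T, hT0, ?_⟩
    calc _ ≤ ∑' z, exitDist (toWeight ν) posAll (fun _ => (T : ℤ)) z *
          ENNReal.ofReal (Real.exp (c * znorm z)) := by
          refine ENNReal.tsum_le_tsum fun z => le_mul_of_one_le_right zero_le ?_
          rw [ENNReal.one_le_ofReal, Real.one_le_exp_iff]
          exact mul_nonneg hc.le (znorm_nonneg z)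
      _ ≤ _ := hexit _
      _ < 1 := by
          rw [ENNReal.ofReal_lt_one]
          refine lt_of_eq_of_lt ?_ hT
          rw [← Real.exp_nat_mul]
          simp only [znorm, Finset.sum_const, Finset.card_univ, Fintype.card_fin, nsmul_eq_mul,
            Int.cast_natCast, Nat.abs_cast, mul_assoc]
          congr 3
          ring
  obtain ⟨k, p, h0, hk, hmem, hp⟩ := hirr x hx (fun _ => (T : ℤ))
    (fun _ => Int.natCast_pos.2 hT0)
  have hback : ∀ j ≤ k, ∑' z, exitDist (toWeight ν) posAll (p (k - j)) z < 1 := by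
    intro j
    induction j with
    | zero => intro _; rwa [Nat.sub_zero, hk]
    | succ j ih =>
      intro hj
      have hlt := ih (by omega)
      have hstep := hp (k - (j + 1)) (by omega)
      rw [show k - (j + 1) + 1 = k - j by omega] at hstep
      set u := p (k - (j + 1))
      set v := p (k - j)
      have hu : u ∈ posAll := hmem _ (by omega)
      have hv : v ∈ posAll := hmem _ (by omega)
      have htot : ∑' w, toWeight ν (w - u) = 1 := by
        rw [← h.tsum_weight, ← (Equiv.subRight u).tsum_eq (toWeight ν)]
        rfl
      rw [tsum_exitDist hu, ← ENNReal.tsum_add]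
      have hterm : ∀ w, (if w ∉ posAll then toWeight ν (w - u) else 0) +
          toWeight ν (w - u) * ∑' z, exitDist (toWeight ν) posAll w z ≤ toWeight ν (w - u) := by
        intro w
        by_cases hw : w ∈ posAll
        · simpa [hw] using mul_le_of_le_one_right (zero_le (a := toWeight ν (w - u))) (hle w hw)
        · simp [hw, exitDist, exitAt_eq_zero hw]
      rw [← htot]
      refine ENNReal.tsum_lt_tsum (i := v) ?_ hterm ?_
      · exact ne_top_of_le_ne_top (by simp [htot]) (ENNReal.tsum_le_tsum hterm)
      · simp only [hv, not_true_eq_false, if_false, zero_add]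
        refine (ENNReal.mul_lt_mul_right (ENNReal.ofReal_pos.2 hstep).ne' ENNReal.ofReal_ne_top hlt
          ).trans_eq (mul_one _)
  have := hback k le_rfl
  rwa [Nat.sub_self, h0] at this

end DriftLaw

end Exit

section Conversion

open scoped ENNReal

variable {V : Type*} [AddCommGroup V]

section Twist

variable {N N' w : V → ℝ≥0∞} {A : Set V}

lemma kernE_mul_twist (hw : ∀ a b, w (a + b) = w a * w b) (hN : ∀ z, N' z = N z * w z)
    (n : ℕ) (x y : V) : kernE N A n x y * w y = w x * kernE N' A n x y := by
  induction n generalizing x with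
  | zero =>
    simp only [kernE]
    split_ifs with h
    · rw [h.1, one_mul, mul_one]
    · simp
  | succ n ih =>
    simp only [kernE, ← ENNReal.tsum_mul_left, ← ENNReal.tsum_mul_right]
    refine tsum_congr fun z => ?_
    rw [mul_assoc, ih]
    split_ifs
    · rw [hN, show w z = w x * w (z - x) by rw [← hw, add_sub_cancel]]
      ring
    · simp

lemma exitAt_mul_twist (hw : ∀ a b, w (a + b) = w a * w b) (hN : ∀ z, N' z = N z * w z)
    (n : ℕ) (x y : V) : exitAt N A n x y * w y = w x * exitAt N' A n x y := by
  simp only [exitAt, ← ENNReal.tsum_mul_left, ← ENNReal.tsum_mul_right]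
  refine tsum_congr fun z => ?_
  rw [← mul_assoc, ← kernE_mul_twist hw hN]
  split_ifs
  · simp
  · rw [hN, show w y = w z * w (y - z) by rw [← hw, add_sub_cancel]]
    ring

end Twist

variable {μ : V → ℝ} {A : Set V}

lemma kernE_le_one (hN : ∑' z, ENNReal.ofReal (μ z) = 1) (n : ℕ) (x y : V) :
    kernE (fun z => ENNReal.ofReal (μ z)) A n x y ≤ 1 :=
  (kernE_le_convPow n x y).trans
    ((ENNReal.le_tsum (y - x)).trans_eq (tsum_convPow hN n))

lemma kern_eq_toReal (hμ : ∀ z, 0 ≤ μ z) (hN : ∑' z, ENNReal.ofReal (μ z) = 1) (n : ℕ) (x y : V) :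
    kern μ A n x y = (kernE (fun z => ENNReal.ofReal (μ z)) A n x y).toReal := by
  induction n generalizing x with
  | zero => simp only [kern, kernE]; split_ifs <;> simp
  | succ n ih =>
    simp only [kern, kernE]
    rw [ENNReal.tsum_toReal_eq]
    · refine tsum_congr fun z => ?_
      rw [ih, ENNReal.toReal_mul]
      split_ifs
      · rw [ENNReal.toReal_ofReal (hμ _)]
      · simp
    · intro z
      refine ENNReal.mul_ne_top ?_ (ne_top_of_le_ne_top ENNReal.one_ne_top (kernE_le_one hN n z y))
      split_ifs <;> simp

lemma green_eq_toReal (hμ : ∀ z, 0 ≤ μ z) (hN : ∑' z, ENNReal.ofReal (μ z) = 1) (x y : V) :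
    green μ A x y = (∑' n, kernE (fun z => ENNReal.ofReal (μ z)) A n x y).toReal := by
  rw [green, ENNReal.tsum_toReal_eq
    fun n => ne_top_of_le_ne_top ENNReal.one_ne_top (kernE_le_one hN n x y)]
  exact tsum_congr fun n => kern_eq_toReal hμ hN n x y

lemma exitExp_eq_toReal (hμ : ∀ z, 0 ≤ μ z) (hN : ∑' z, ENNReal.ofReal (μ z) = 1) {g : V → ℝ}
    (hg : ∀ z, 0 ≤ g z) (x : V)
    (hfin : ∑' y, exitDist (fun z => ENNReal.ofReal (μ z)) A x y * ENNReal.ofReal (g y) ≠ ∞) :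
    exitExp μ A Set.univ g x =
      (∑' y, exitDist (fun z => ENNReal.ofReal (μ z)) A x y * ENNReal.ofReal (g y)).toReal := by
  set N : V → ℝ≥0∞ := fun z => ENNReal.ofReal (μ z) with hNdef
  have hcomm : ∑' y, exitDist N A x y * ENNReal.ofReal (g y) =
      ∑' n, ∑' z, kernE N A n x z *
        ∑' y, (if y ∉ A then N (y - z) else 0) * ENNReal.ofReal (g y) := by
    simp only [exitDist, ← ENNReal.tsum_mul_right]
    rw [ENNReal.tsum_comm]
    refine tsum_congr fun n => ?_
    simp only [exitAt, ← ENNReal.tsum_mul_right, ← ENNReal.tsum_mul_left]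
    rw [ENNReal.tsum_comm]
    simp only [mul_assoc]
  rw [hcomm] at hfin ⊢
  have hfin1 : ∀ n, ∑' z, kernE N A n x z *
        ∑' y, (if y ∉ A then N (y - z) else 0) * ENNReal.ofReal (g y) ≠ ∞ :=
    ENNReal.ne_top_of_tsum_ne_top hfin
  rw [exitExp, ENNReal.tsum_toReal_eq hfin1]
  refine tsum_congr fun n => ?_
  rw [ENNReal.tsum_toReal_eq (ENNReal.ne_top_of_tsum_ne_top (hfin1 n))]
  refine tsum_congr fun z => ?_
  rw [ENNReal.toReal_mul, kern_eq_toReal hμ hN]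
  congr 1
  rw [ENNReal.tsum_toReal_eq]
  · refine tsum_congr fun y => ?_
    rw [ENNReal.toReal_mul, ENNReal.toReal_ofReal (hg y)]
    congr 1
    by_cases hy : y ∈ A
    · simp [hy]
    · simp [hy, hNdef, ENNReal.toReal_ofReal (hμ _)]
  · intro y
    refine ENNReal.mul_ne_top ?_ ENNReal.ofReal_ne_top
    split_ifs <;> simp [hNdef]

end Conversion

section Tilt

open scoped ENNReal

variable {d : ℕ} {μ : (Fin d → ℤ) → ℝ}

lemma exp_mul_znorm_le (r : ℝ) (z : Fin d → ℤ) :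
    Real.exp (r * znorm z) ≤ ∑ σ : Fin d → Bool,
      Real.exp (dotZ (fun i => if σ i then r else -r) z) := by
  have h : r * znorm z = dotZ (fun i => if decide (0 ≤ z i) then r else -r) z := by
    rw [znorm, dotZ, Finset.mul_sum]
    refine Finset.sum_congr rfl fun i _ => ?_
    by_cases hi : 0 ≤ z i
    · have : (0 : ℝ) ≤ z i := by exact_mod_cast hi
      simp [hi, abs_of_nonneg this]
    · have : (z i : ℝ) ≤ 0 := by exact_mod_cast (not_le.1 hi).le
      simp [hi, abs_of_nonpos this]
  rw [h]
  exact Finset.single_le_sum (f := fun σ : Fin d → Bool =>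
    Real.exp (dotZ (fun i => if σ i then r else -r) z)) (fun _ _ => (Real.exp_pos _).le)
    (Finset.mem_univ fun i => decide (0 ≤ z i))

lemma summable_of_tsum_ofReal_ne_top {α : Type*} {f : α → ℝ} (hf : ∀ a, 0 ≤ f a)
    (h : ∑' a, ENNReal.ofReal (f a) ≠ ∞) : Summable f :=
  (ENNReal.summable_toReal h).congr fun a => ENNReal.toReal_ofReal (hf a)

/-- Finiteness of the jump generating function near `a` gives exponential moments of the law
tilted by `a`. -/
lemma exists_summable_tilt (hμ : ∀ z, 0 ≤ μ z) (hA2 : A2 μ) {a : Fin d → ℝ} (ha : a ∈ Dset μ) :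
    ∃ r : ℝ, 0 < r ∧ Summable fun z => μ z * Real.exp (dotZ a z) * Real.exp (r * znorm z) := by
  obtain ⟨U, hU, hDU, hfin⟩ := hA2
  obtain ⟨ε, hε, hball⟩ := Metric.isOpen_iff.1 hU a (hDU ha)
  refine ⟨ε / 2, half_pos hε, summable_of_tsum_ofReal_ne_top
    (fun z => mul_nonneg (mul_nonneg (hμ z) (Real.exp_pos _).le) (Real.exp_pos _).le) ?_⟩
  set s : (Fin d → Bool) → Fin d → ℝ := fun σ i => if σ i then ε / 2 else -(ε / 2) with hs
  have hmem : ∀ σ, a + s σ ∈ U := by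
    intro σ
    refine hball ?_
    rw [Metric.mem_ball, dist_eq_norm, add_sub_cancel_left]
    refine lt_of_le_of_lt ((pi_norm_le_iff_of_nonneg (half_pos hε).le).2 fun i => ?_) (half_lt_self hε)
    simp only [hs]
    split_ifs
    · rw [Real.norm_of_nonneg (half_pos hε).le]
    · rw [norm_neg, Real.norm_of_nonneg (half_pos hε).le]
  refine ne_top_of_le_ne_top (ENNReal.sum_ne_top.2 fun σ (_ : σ ∈ Finset.univ) =>
    hfin _ (hmem σ)) ?_
  simp only [phiE]
  rw [← Summable.tsum_finsetSum fun _ _ => ENNReal.summable]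
  refine ENNReal.tsum_le_tsum fun z => ?_
  rw [← ENNReal.ofReal_sum_of_nonneg fun σ _ => mul_nonneg (hμ z) (Real.exp_pos _).le]
  refine ENNReal.ofReal_le_ofReal ?_
  simp only [dotZ_add_left, Real.exp_add, ← mul_assoc]
  rw [← Finset.mul_sum]
  exact mul_le_mul_of_nonneg_left (exp_mul_znorm_le _ z) (mul_nonneg (hμ z) (Real.exp_pos _).le)

lemma phiE_eq_ofReal (hμ : ∀ z, 0 ≤ μ z) {a : Fin d → ℝ}
    (hs : Summable fun z => μ z * Real.exp (dotZ a z)) :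
    phiE μ a = ENNReal.ofReal (∑' z, μ z * Real.exp (dotZ a z)) :=
  (ENNReal.ofReal_tsum_of_nonneg (fun z => mul_nonneg (hμ z) (Real.exp_pos _).le) hs).symm

section Moments

variable {ν : (Fin d → ℤ) → ℝ} {r : ℝ}

lemma hasSum_mean (hν : ∀ z, 0 ≤ ν z) (hr : 0 < r)
    (hs : Summable fun z => ν z * Real.exp (r * znorm z)) (i : Fin d) :
    HasSum (fun z => ν z * (z i : ℝ)) (∑' z, ν z * (z i : ℝ)) := by
  obtain ⟨s₀, hs₀, C, hC, hb⟩ := exists_laplace_bound hν hr hs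
  have h := (hb (fun z => s₀ * z i) s₀ le_rfl fun z => by
    rw [abs_mul, abs_of_pos hs₀]
    exact mul_le_mul_of_nonneg_left (by linarith [abs_apply_le_znorm z i]) hs₀.le).1
  refine Summable.hasSum ((h.mul_left s₀⁻¹).congr fun z => ?_)
  field_simp

/-- Moving in a direction of negative drift decreases the Laplace transform. -/
lemma exists_tsum_exp_le_one (hν : ∀ z, 0 ≤ ν z) (hr : 0 < r)
    (hs : Summable fun z => ν z * Real.exp (r * znorm z)) (hle : ∑' z, ν z ≤ 1)
    (v : Fin d → ℝ)
    (hv : ∑' z, ν z < 1 ∨ dotR v (fun i => ∑' z, ν z * (z i : ℝ)) < 0) :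
    ∃ t : ℝ, 0 < t ∧ Summable (fun z => ν z * Real.exp (dotZ (t • v) z)) ∧
      ∑' z, ν z * Real.exp (dotZ (t • v) z) < 1 := by
  obtain ⟨s₀, hs₀, C, hC, hb⟩ := exists_laplace_bound hν hr hs
  set b := dotR v (fun i => ∑' z, ν z * (z i : ℝ)) with hbdef
  set s := ∑ i, |v i| with hsdef
  have hs0 : 0 ≤ s := Finset.sum_nonneg fun _ _ => abs_nonneg _
  have h1 : ∀ᶠ t : ℝ in 𝓝[>] 0, t * s < s₀ := by
    have : Tendsto (fun t : ℝ => t * s) (𝓝[>] 0) (𝓝 (0 * s)) :=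
      ((continuous_id.mul continuous_const).tendsto 0).mono_left nhdsWithin_le_nhds
    rw [zero_mul] at this
    exact this.eventually (gt_mem_nhds hs₀)
  have h2 : ∀ᶠ t : ℝ in 𝓝[>] 0, ∑' z, ν z + t * b + C * (t * s) ^ 2 < 1 := by
    rcases hv with hv | hv
    · have : Tendsto (fun t : ℝ => ∑' z, ν z + t * b + C * (t * s) ^ 2) (𝓝[>] 0)
          (𝓝 (∑' z, ν z + 0 * b + C * (0 * s) ^ 2)) :=
        (Continuous.tendsto (by fun_prop) 0).mono_left nhdsWithin_le_nhds
      refine this.eventually (gt_mem_nhds ?_)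
      simpa using hv
    · have : Tendsto (fun t : ℝ => b + C * t * s ^ 2) (𝓝[>] 0) (𝓝 (b + C * 0 * s ^ 2)) :=
        (Continuous.tendsto (by fun_prop) 0).mono_left nhdsWithin_le_nhds
      have := this.eventually (gt_mem_nhds (show b + C * 0 * s ^ 2 < 0 by simpa using hv))
      filter_upwards [this, self_mem_nhdsWithin] with t ht ht0
      have := mul_neg_of_pos_of_neg ht0 ht
      nlinarith
  obtain ⟨t, ⟨ht1, ht2⟩, ht0⟩ := ((h1.and h2).and
    (self_mem_nhdsWithin (s := Set.Ioi (0 : ℝ)))).exists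
  have ht0' : 0 < t := ht0
  obtain ⟨-, hsum, hbd⟩ := hb (dotZ (t • v)) (t * s) ht1.le fun z => by
    refine (abs_dotZ_le (K := t * s) (fun i => ?_) z).trans ?_
    · rw [Pi.smul_apply, smul_eq_mul, abs_mul, abs_of_pos ht0']
      exact mul_le_mul_of_nonneg_left
        (Finset.single_le_sum (f := fun j => |v j|) (fun _ _ => abs_nonneg _)
          (Finset.mem_univ i)) ht0'.le
    · exact mul_le_mul_of_nonneg_left (by linarith) (mul_nonneg ht0'.le hs0)
  refine ⟨t, ht0, hsum, hbd.trans_lt ?_⟩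
  have hm := hasSum_mul_dotZ (hasSum_mean hν hr hs) (t • v)
  rw [hm.tsum_eq]
  have : dotR (t • v) (fun i => ∑' z, ν z * (z i : ℝ)) = t * b := by
    rw [hbdef, dotR, dotR, Finset.mul_sum]
    exact Finset.sum_congr rfl fun i _ => by rw [Pi.smul_apply, smul_eq_mul, mul_assoc]
  rwa [this]

end Moments

lemma exists_pos_smul_of_halfspace {q m : Fin d → ℝ} (hq : q ≠ 0) (hm : m ≠ 0)
    (h : ∀ v, dotR v m < 0 → dotR v q ≤ 0) : ∃ l : ℝ, 0 < l ∧ ∀ i, m i = l * q i := by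
  have hpos : ∀ v : Fin d → ℝ, v ≠ 0 → 0 < dotR v v := by
    intro v hv
    obtain ⟨i, hi⟩ := Function.ne_iff.1 hv
    exact Finset.sum_pos' (fun _ _ => mul_self_nonneg _)
      ⟨i, Finset.mem_univ i, mul_self_pos.2 hi⟩
  have hlin : ∀ (s t : ℝ) (u v w : Fin d → ℝ),
      dotR (s • u + t • v) w = s * dotR u w + t * dotR v w := by
    intro s t u v w
    simp only [dotR, Finset.mul_sum, ← Finset.sum_add_distrib]
    refine Finset.sum_congr rfl fun i _ => ?_
    simp only [Pi.add_apply, Pi.smul_apply, smul_eq_mul]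
    ring
  have hcomm : ∀ u v : Fin d → ℝ, dotR u v = dotR v u := fun u v =>
    Finset.sum_congr rfl fun i _ => mul_comm _ _
  have hmm := hpos m hm
  have hzero : ∀ w, dotR w m = 0 → dotR w q ≤ 0 := by
    intro w hw
    have h1 : ∀ s > 0, dotR w q ≤ s * dotR m q := by
      intro s hs
      have := h ((1 : ℝ) • w + (-s) • m) (by rw [hlin, hw]; nlinarith)
      rw [hlin] at this
      linarith
    have : Tendsto (fun s : ℝ => s * dotR m q) (𝓝[>] 0) (𝓝 (0 * dotR m q)) :=
      ((continuous_id.mul continuous_const).tendsto 0).mono_left nhdsWithin_le_nhds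
    rw [zero_mul] at this
    exact ge_of_tendsto this (eventually_of_mem self_mem_nhdsWithin h1)
  set w := dotR m m • q + (-dotR q m) • m with hw
  have hwm : dotR w m = 0 := by rw [hw, hlin]; ring
  have hwq : dotR w q ≤ 0 := hzero w hwm
  have hww : w = 0 := by
    by_contra hne
    have h1 := hpos w hne
    have h2 : dotR w w = dotR m m * dotR w q + (-dotR q m) * dotR w m := by
      conv_lhs => rw [hcomm, hw, hlin, ← hw]
      rw [hcomm q, hcomm m w]
    rw [hwm] at h2
    nlinarith
  have hrel : ∀ i, dotR m m * q i = dotR q m * m i := by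
    intro i
    have := congrFun hww i
    simp only [hw, Pi.add_apply, Pi.smul_apply, smul_eq_mul, Pi.zero_apply] at this
    linarith
  have hqm0 : 0 ≤ dotR q m := by
    have := h ((-1 : ℝ) • m + (0 : ℝ) • m) (by rw [hlin]; linarith)
    rw [hlin, hcomm m q] at this
    linarith
  have hqm : 0 < dotR q m := by
    refine lt_of_le_of_ne hqm0 fun h0 => hq ?_
    funext i
    have := hrel i
    rw [← h0, zero_mul] at this
    exact (mul_eq_zero.1 this).resolve_left hmm.ne'
  refine ⟨dotR m m / dotR q m, div_pos hmm hqm, fun i => ?_⟩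
  have := hrel i
  field_simp
  linarith

/-- At the point of `D` with positive outward normal `q`, the tilted walk has a drift proportional
to `q`. -/
lemma exists_driftLaw_tilt (hμ : ∀ z, 0 ≤ μ z) (hsum : HasSum μ 1) (hA1 : A1 μ) (hA2 : A2 μ)
    (hA3 : A3 μ) {q aq : Fin d → ℝ} (hq : ∀ i, 0 < q i) (haqD : aq ∈ Dset μ)
    (haqMax : ∀ a ∈ Dset μ, dotR a q ≤ dotR aq q) :
    ∃ l : ℝ, 0 < l ∧ DriftLaw (fun z => μ z * Real.exp (dotZ aq z)) (fun i => l * q i) := by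
  have hd : 0 < d := by
    rcases Nat.eq_zero_or_pos d with rfl | h
    · exact absurd (Subsingleton.elim _ _) hA3
    · exact h
  have hq0 : q ≠ 0 := fun h0 => (hq ⟨0, hd⟩).ne' (congrFun h0 _)
  set ν : (Fin d → ℤ) → ℝ := fun z => μ z * Real.exp (dotZ aq z) with hνdef
  have hν : ∀ z, 0 ≤ ν z := fun z => mul_nonneg (hμ z) (Real.exp_pos _).le
  obtain ⟨r, hr, hs⟩ := exists_summable_tilt hμ hA2 haqD
  have hνs : Summable ν := summable_of_tsum_ofReal_ne_top hν
    (ne_top_of_le_ne_top ENNReal.one_ne_top haqD)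
  have hle : ∑' z, ν z ≤ 1 := by
    have : phiE μ aq ≤ 1 := haqD
    rwa [phiE_eq_ofReal hμ hνs, ENNReal.ofReal_le_one] at this
  set m : Fin d → ℝ := fun i => ∑' z, ν z * (z i : ℝ) with hm
  have hshift : ∀ v z, ν z * Real.exp (dotZ v z) = μ z * Real.exp (dotZ (aq + v) z) := by
    intro v z
    rw [dotZ_add_left, Real.exp_add, hνdef, mul_assoc]
  have hhalf : ∀ v, (∑' z, ν z < 1 ∨ dotR v m < 0) → dotR v q ≤ 0 := by
    intro v hv
    obtain ⟨t, ht, h1, h2⟩ := exists_tsum_exp_le_one hν hr hs hle v hv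
    simp only [hshift] at h1 h2
    have hD : aq + t • v ∈ Dset μ := by
      change phiE μ _ ≤ 1
      rw [phiE_eq_ofReal hμ h1, ENNReal.ofReal_le_one]
      exact h2.le
    have h3 := haqMax _ hD
    have h4 : dotR (aq + t • v) q = dotR aq q + t * dotR v q := by
      simp only [dotR, Finset.mul_sum, ← Finset.sum_add_distrib]
      refine Finset.sum_congr rfl fun i _ => ?_
      simp only [Pi.add_apply, Pi.smul_apply, smul_eq_mul]
      ring
    rw [h4] at h3
    by_contra! hcon
    have := mul_pos ht hcon
    linarith
  have hone : ∑' z, ν z = 1 := by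
    refine le_antisymm hle (not_lt.1 fun hlt => ?_)
    have h1 := hhalf q (Or.inl hlt)
    have h2 : 0 < dotR q q := Finset.sum_pos (fun i _ => mul_pos (hq i) (hq i)) ⟨⟨0, hd⟩, Finset.mem_univ _⟩
    linarith
  have hmean := hasSum_mean hν hr hs
  have hm0 : m ≠ 0 := by
    intro hm0
    have h0D : (0 : Fin d → ℝ) ∈ Dset μ := by
      have hz : ∀ z : Fin d → ℤ, dotZ (0 : Fin d → ℝ) z = 0 := fun z => by simp [dotZ]
      change phiE μ 0 ≤ 1
      rw [phiE_eq_ofReal hμ (by simpa [hz] using hsum.summable)]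
      simp [hz, hsum.tsum_eq]
    obtain ⟨r', hr', hs'⟩ := exists_summable_tilt hμ hA2 h0D
    have hs'' : Summable fun z => μ z * Real.exp (r' * znorm z) := by
      simpa [dotZ] using hs'
    obtain ⟨t, -, h1, h2⟩ := exists_tsum_exp_le_one hμ hr' hs'' hsum.tsum_eq.le (-Mvec μ)
      (Or.inr (by
        obtain ⟨i, hi⟩ := Function.ne_iff.1 hA3
        have : 0 < ∑ i, Mvec μ i * Mvec μ i := Finset.sum_pos' (fun _ _ => mul_self_nonneg _)
          ⟨i, Finset.mem_univ i, mul_self_pos.2 hi⟩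
        change ∑ i, (-Mvec μ) i * Mvec μ i < 0
        simp only [Pi.neg_apply, neg_mul, Finset.sum_neg_distrib]
        linarith))
    set b := t • (-Mvec μ)
    have heq : ∀ z, μ z * Real.exp (dotZ b z) = ν z * Real.exp (dotZ (b - aq) z) := fun z => by
      rw [hshift, add_sub_cancel]
    simp only [heq] at h1 h2
    have hlin := hasSum_mul_dotZ hmean (b - aq)
    have hz : dotR (b - aq) (fun i => ∑' z, ν z * (z i : ℝ)) = 0 := by
      change dotR (b - aq) m = 0
      rw [hm0]; simp [dotR]
    rw [hz] at hlin
    have hge : 1 + 0 ≤ ∑' z, ν z * Real.exp (dotZ (b - aq) z) := by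
      refine hasSum_le (fun z => ?_) ((hone ▸ hνs.hasSum).add hlin) h1.hasSum
      have := mul_le_mul_of_nonneg_left (Real.add_one_le_exp (dotZ (b - aq) z)) (hν z)
      linarith
    linarith
  obtain ⟨l, hl, hml⟩ := exists_pos_smul_of_halfspace hq0 hm0 fun v hv => hhalf v (Or.inr hv)
  refine ⟨l, hl, hν, hone ▸ hνs.hasSum, ⟨r, hr, hs⟩, fun i => hml i ▸ hmean i,
    fun i => mul_pos hl (hq i), hd, fun x _ x' _ => ?_⟩
  obtain ⟨k, c, h0, hk, -, hc⟩ := hA1 ∅ x (by simp [posDom]) x' (by simp [posDom])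
  exact ⟨k, c, h0, hk, fun _ _ => trivial, fun j hj => mul_pos (hc j hj) (Real.exp_pos _)⟩

end Tilt

section HarmonicLimit

open scoped ENNReal

variable {d : ℕ} {μ ν : (Fin d → ℤ) → ℝ} {m : Fin d → ℝ}

/-- Probability that the walk with step law `ν` started at `x` ever leaves the positive orthant. -/
noncomputable def exitMass (ν : (Fin d → ℤ) → ℝ) (x : Fin d → ℤ) : ℝ≥0∞ :=
  ∑' z, exitDist (toWeight ν) posAll x z

lemma DriftLaw.one_sub_exitMass (h : DriftLaw ν m) (hirr : Irred ν posAll) {x : Fin d → ℤ}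
    (hx : x ∈ posAll) :
    HasSum (fun y => if y ∈ posAll then ν (y - x) * (1 - (exitMass ν y).toReal) else 0)
      (1 - (exitMass ν x).toReal) := by
  have hrec : exitMass ν x = (∑' z, if z ∉ posAll then toWeight ν (z - x) else 0) +
      ∑' w, toWeight ν (w - x) * exitMass ν w := tsum_exitDist hx
  have htop : exitMass ν x ≠ ∞ := (h.tsum_exitDist_lt_one hirr hx).ne_top
  rw [hrec] at htop ⊢
  obtain ⟨h1, h2⟩ := ENNReal.add_ne_top.1 htop
  have hν : HasSum (fun w => ν (w - x)) 1 := (Equiv.subRight x).hasSum_iff.2 h.hasSum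
  have ha := ENNReal.hasSum_toReal h1
  have hb := ENNReal.hasSum_toReal h2
  rw [← ENNReal.tsum_toReal_eq (ENNReal.ne_top_of_tsum_ne_top h1)] at ha
  rw [← ENNReal.tsum_toReal_eq (ENNReal.ne_top_of_tsum_ne_top h2)] at hb
  rw [ENNReal.toReal_add h1 h2]
  refine (congrArg (fun f => HasSum f _) (funext fun y => ?_)).mp (hν.sub (ha.add hb))
  by_cases hy : y ∈ posAll
  · simp [hy, toWeight, h.nonneg]
    ring
  · have : exitMass ν y = 0 :=
      ENNReal.tsum_eq_zero.2 fun z => ENNReal.tsum_eq_zero.2 fun n => exitAt_eq_zero hy n z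
    simp [hy, toWeight, h.nonneg, this]

section TiltedLaw

variable {a : Fin d → ℝ}

lemma ofReal_exp_dotZ_add (x y : Fin d → ℤ) :
    ENNReal.ofReal (Real.exp (dotZ a (x + y))) =
      ENNReal.ofReal (Real.exp (dotZ a x)) * ENNReal.ofReal (Real.exp (dotZ a y)) := by
  rw [dotZ_add, Real.exp_add, ENNReal.ofReal_mul (Real.exp_pos _).le]

lemma toWeight_tilt (hμ : ∀ z, 0 ≤ μ z) (z : Fin d → ℤ) :
    toWeight (fun z => μ z * Real.exp (dotZ a z)) z =
      ENNReal.ofReal (μ z) * ENNReal.ofReal (Real.exp (dotZ a z)) :=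
  ENNReal.ofReal_mul (hμ z)

lemma tsum_ofReal_eq_one (hμ : ∀ z, 0 ≤ μ z) (hsum : HasSum μ 1) :
    ∑' z, ENNReal.ofReal (μ z) = 1 := by
  rw [← ENNReal.ofReal_tsum_of_nonneg hμ hsum.summable, hsum.tsum_eq, ENNReal.ofReal_one]

lemma green_eq_tilt (hμ : ∀ z, 0 ≤ μ z) (hsum : HasSum μ 1) (x y : Fin d → ℤ) :
    green μ posAll x y = Real.exp (dotZ a x) * (Real.exp (dotZ a y))⁻¹ *
      (∑' n, kernE (toWeight fun z => μ z * Real.exp (dotZ a z)) posAll n x y).toReal := by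
  have hE : (∑' n, kernE (fun z => ENNReal.ofReal (μ z)) posAll n x y) *
      ENNReal.ofReal (Real.exp (dotZ a y)) = ENNReal.ofReal (Real.exp (dotZ a x)) *
      ∑' n, kernE (toWeight fun z => μ z * Real.exp (dotZ a z)) posAll n x y := by
    rw [← ENNReal.tsum_mul_right, ← ENNReal.tsum_mul_left]
    exact tsum_congr fun n => kernE_mul_twist (w := fun z => ENNReal.ofReal (Real.exp (dotZ a z)))
      ofReal_exp_dotZ_add (toWeight_tilt hμ) n x y
  have := congrArg ENNReal.toReal hE
  rw [ENNReal.toReal_mul, ENNReal.toReal_mul, ENNReal.toReal_ofReal (Real.exp_pos _).le,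
    ENNReal.toReal_ofReal (Real.exp_pos _).le, ← green_eq_toReal hμ (tsum_ofReal_eq_one hμ hsum)]
    at this
  have hpos := Real.exp_pos (dotZ a y)
  field_simp
  exact this

lemma hq4_eq_tilt (hμ : ∀ z, 0 ≤ μ z) (hsum : HasSum μ 1) {x : Fin d → ℤ}
    (hfin : exitMass (fun z => μ z * Real.exp (dotZ a z)) x ≠ ∞) :
    hq4 μ a x = Real.exp (dotZ a x) *
      (1 - (exitMass (fun z => μ z * Real.exp (dotZ a z)) x).toReal) := by
  have hE : ∑' z, exitDist (fun z => ENNReal.ofReal (μ z)) posAll x z *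
      ENNReal.ofReal (Real.exp (dotZ a z)) = ENNReal.ofReal (Real.exp (dotZ a x)) *
      exitMass (fun z => μ z * Real.exp (dotZ a z)) x := by
    simp only [exitMass, exitDist, ← ENNReal.tsum_mul_right, ← ENNReal.tsum_mul_left]
    exact tsum_congr fun z => tsum_congr fun n =>
      exitAt_mul_twist (w := fun z => ENNReal.ofReal (Real.exp (dotZ a z)))
        ofReal_exp_dotZ_add (toWeight_tilt hμ) n x z
  rw [hq4, exitExp_eq_toReal hμ (tsum_ofReal_eq_one hμ hsum) (fun z => (Real.exp_pos _).le) x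
    (hE ▸ ENNReal.mul_ne_top ENNReal.ofReal_ne_top hfin), hE, ENNReal.toReal_mul,
    ENNReal.toReal_ofReal (Real.exp_pos _).le]
  ring

end TiltedLaw

/-- A sequence escaping in the direction `q` follows the drift `l • q` for suitable times. -/
lemma exists_tendsto_dirFilter {q : Fin d → ℝ} (hq1 : rnorm q = 1) (hq : ∀ i, 0 < q i) {l : ℝ}
    (hl : 0 < l) {xs : ℕ → Fin d → ℤ} (hx : Tendsto (fun k => znorm (xs k)) atTop atTop)
    (hdir : Tendsto (fun k i => (xs k i : ℝ) / znorm (xs k)) atTop (𝓝 q)) :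
    ∃ n : ℕ → ℕ, Tendsto (fun k => (n k, xs k)) atTop (dirFilter fun i => l * q i) := by
  set n : ℕ → ℕ := fun k => ⌈znorm (xs k) / l⌉₊ with hn
  have hsumq : ∑ i, q i = 1 := by
    rw [← hq1, rnorm]
    exact Finset.sum_congr rfl fun i _ => (abs_of_pos (hq i)).symm
  have hntop : Tendsto n atTop atTop := tendsto_nat_ceil_atTop.comp (hx.atTop_div_const hl)
  refine ⟨n, tendsto_inf.2 ⟨tendsto_comap_iff.2 hntop, tendsto_comap_iff.2 ?_⟩⟩
  have hb : Tendsto (fun k => l * ∑ i, |(xs k i : ℝ) / znorm (xs k) - q i| + l / n k) atTop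
      (𝓝 (l * ∑ i, |q i - q i| + 0)) := by
    refine ((tendsto_finsetSum _ fun i _ => ?_).const_mul l).add
      (tendsto_const_nhds.div_atTop (tendsto_natCast_atTop_atTop.comp hntop))
    exact ((tendsto_pi_nhds.1 hdir i).sub_const _).abs
  simp only [sub_self, abs_zero, Finset.sum_const_zero, mul_zero, add_zero] at hb
  refine squeeze_zero' (Eventually.of_forall fun k =>
    div_nonneg (devZ_nonneg _ _) (Nat.cast_nonneg _)) ?_ hb
  filter_upwards [hx.eventually_gt_atTop 0] with k hk
  have hnl : znorm (xs k) ≤ n k * l := (div_le_iff₀ hl).1 (Nat.le_ceil _)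
  have hnu : n k * l - znorm (xs k) ≤ l := by
    have := (Nat.ceil_lt_add_one (div_pos hk hl).le).le
    have := mul_le_mul_of_nonneg_right this hl.le
    rw [add_mul, div_mul_cancel₀ _ hl.ne', one_mul] at this
    linarith
  have hnpos : (0 : ℝ) < n k := pos_of_mul_pos_left (hk.trans_le hnl) hl.le
  set S := ∑ i, |(xs k i : ℝ) / znorm (xs k) - q i| with hS
  have hS0 : 0 ≤ S := Finset.sum_nonneg fun _ _ => abs_nonneg _
  have hdev : devZ (fun i => l * q i) (n k) (xs k) ≤ znorm (xs k) * S +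
      (n k * l - znorm (xs k)) := by
    calc devZ (fun i => l * q i) (n k) (xs k)
        ≤ ∑ i, (znorm (xs k) * |(xs k i : ℝ) / znorm (xs k) - q i| +
            (n k * l - znorm (xs k)) * q i) := by
          refine Finset.sum_le_sum fun i _ => ?_
          have heq : (xs k i : ℝ) - n k * (l * q i) =
              znorm (xs k) * ((xs k i : ℝ) / znorm (xs k) - q i) -
                (n k * l - znorm (xs k)) * q i := by
            field_simp
            ring
          rw [heq]
          refine (abs_sub _ _).trans_eq ?_
          rw [abs_mul, abs_of_pos hk,
            abs_of_nonneg (mul_nonneg (sub_nonneg.2 hnl) (hq i).le)]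
      _ = _ := by
          rw [Finset.sum_add_distrib, ← Finset.mul_sum, ← Finset.mul_sum, hsumq, mul_one]
  change devZ (fun i => l * q i) (n k) (xs k) / n k ≤ _
  rw [div_le_iff₀ hnpos, add_mul, div_mul_cancel₀ _ hnpos.ne']
  nlinarith [mul_le_mul_of_nonneg_right hnl hS0]

end HarmonicLimit

lemma posDom_univ {d : ℕ} : posDom (Set.univ : Set (Fin d)) = posAll := by
  ext x
  simp [posDom, posAll]

theorem statement4 {d : ℕ} (μ : (Fin d → ℤ) → ℝ)
    (hnn : ∀ z, 0 ≤ μ z) (hsum : HasSum μ 1)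
    (hA1 : A1 μ) (hA2 : A2 μ) (hA3 : A3 μ)
    (q : Fin d → ℝ) (hq1 : rnorm q = 1) (hq2 : ∀ i, 0 < q i)
    -- `a(q)` : the (unique) maximizer over `D` of `a ↦ a·q`
    (aq : Fin d → ℝ) (haqD : aq ∈ Dset μ) (haqMax : ∀ a ∈ Dset μ, dotR a q ≤ dotR aq q)
    (x₀ : Fin d → ℤ) (hx₀ : x₀ ∈ posAll) :
    -- (i)
    ((∀ x ∈ posAll, 0 < hq4 μ aq x) ∧ HarmOn μ posAll (hq4 μ aq)) ∧
    -- (ii)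
    (∀ xs : ℕ → (Fin d → ℤ), (∀ n, xs n ∈ posAll) →
      Tendsto (fun n => znorm (xs n)) atTop atTop →
      Tendsto (fun n i => (xs n i : ℝ) / znorm (xs n)) atTop (𝓝 q) →
      Fundamental μ posAll x₀ xs ∧
      ∀ x ∈ posAll,
        Tendsto (fun n => green μ posAll x (xs n) / green μ posAll x₀ (xs n)) atTop
          (𝓝 (hq4 μ aq x / hq4 μ aq x₀))) := by
  obtain ⟨l, hl, hν⟩ := exists_driftLaw_tilt hnn hsum hA1 hA2 hA3 hq2 haqD haqMax
  set ν : (Fin d → ℤ) → ℝ := fun z => μ z * Real.exp (dotZ aq z) with hνdef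
  have hirr : Irred ν posAll := by
    intro x hx x' hx'
    rw [← posDom_univ] at hx hx' ⊢
    obtain ⟨k, c, h0, hk, hA, hc⟩ := hA1 Set.univ x hx x' hx'
    exact ⟨k, c, h0, hk, hA, fun j hj => mul_pos (hc j hj) (Real.exp_pos _)⟩
  have hlt : ∀ x ∈ posAll, exitMass ν x < 1 := fun x hx => hν.tsum_exitDist_lt_one hirr hx
  have hh : ∀ x ∈ posAll, hq4 μ aq x = Real.exp (dotZ aq x) * (1 - (exitMass ν x).toReal) :=
    fun x hx => hq4_eq_tilt hnn hsum (hlt x hx).ne_top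
  have hsub : ∀ x ∈ posAll, 0 < 1 - (exitMass ν x).toReal := fun x hx => by
    have := (ENNReal.toReal_lt_toReal (hlt x hx).ne_top ENNReal.one_ne_top).2 (hlt x hx)
    rw [ENNReal.toReal_one] at this
    linarith
  have hpos : ∀ x ∈ posAll, 0 < hq4 μ aq x := fun x hx => by
    rw [hh x hx]
    exact mul_pos (Real.exp_pos _) (hsub x hx)
  refine ⟨⟨hpos, fun x hx => ?_⟩, fun xs hxs hxtop hdir => ?_⟩
  · rw [hh x hx, ← (hν.one_sub_exitMass hirr hx).tsum_eq, ← tsum_mul_left]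
    refine tsum_congr fun y => ?_
    by_cases hy : y ∈ posAll
    · rw [if_pos hy, if_pos hy, hh y hy, hνdef,
        show dotZ aq y = dotZ aq x + dotZ aq (y - x) by rw [← dotZ_add, add_sub_cancel],
        Real.exp_add]
      ring
    · rw [if_neg hy, if_neg hy, mul_zero]
  · have hlim : ∀ x ∈ posAll, Tendsto (fun n => green μ posAll x (xs n) / green μ posAll x₀ (xs n))
        atTop (𝓝 (hq4 μ aq x / hq4 μ aq x₀)) := by
      intro x hx
      obtain ⟨n, hn⟩ := exists_tendsto_dirFilter hq1 hq2 hl hxtop hdir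
      obtain ⟨c, hc, θ, -, -, K, -, hexit⟩ := hν.exists_tsum_exitDist_mul_exp_le
      have hG : ∀ z ∈ posAll, Tendsto (fun k =>
          ((∑' j, kernE (toWeight ν) posAll j z (xs k)) / convGreen (toWeight ν) (xs k)).toReal)
          atTop (𝓝 (1 - (exitMass ν z).toReal)) := by
        intro z hz
        have h1 := ((hν.tendsto_tsum_kernE_div hz hc
          (ne_top_of_le_ne_top ENNReal.ofReal_ne_top (hexit z))).2).comp hn
        have h2 := (ENNReal.tendsto_toReal
          (ne_top_of_le_ne_top ENNReal.one_ne_top tsub_le_self)).comp h1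
        change Tendsto _ _ (𝓝 (1 - exitMass ν z).toReal) at h2
        rwa [ENNReal.toReal_sub_of_le (hlt z hz).le ENNReal.one_ne_top, ENNReal.toReal_one] at h2
      have h3 := (((hG x hx).const_mul (Real.exp (dotZ aq x))).div
        ((hG x₀ hx₀).const_mul (Real.exp (dotZ aq x₀))) (hh x₀ hx₀ ▸ (hpos x₀ hx₀).ne'))
      rw [hh x hx, hh x₀ hx₀]
      refine h3.congr fun k => ?_
      have hg0 : (convGreen (toWeight ν) (xs k)).toReal ≠ 0 :=
        (ENNReal.toReal_pos (hν.convGreen_pos _).ne' (hν.convGreen_ne_top _)).ne'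
      have he := (Real.exp_pos (dotZ aq (xs k))).ne'
      rw [green_eq_tilt hnn hsum (a := aq) x, green_eq_tilt hnn hsum (a := aq) x₀]
      simp only [Pi.div_apply, ENNReal.toReal_div]
      rw [← hνdef, ← mul_div_assoc, ← mul_div_assoc, div_div_div_cancel_right₀ hg0,
        mul_right_comm _ _⁻¹, mul_right_comm _ _⁻¹, mul_div_mul_right _ _ (inv_ne_zero he)]
    exact ⟨fun x hx => ⟨_, hlim x hx⟩, hlim⟩
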